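/- For every vector field u ∈ H¹(Ω)³ with div u = 0 in Ω, it holds that ∫_Ω gρ₀'|u₃|² ≤ ∫_Γ gρ₊|u₃|² + Λ² ∫_Ω ρ₀|u|² + (Λ/2) ∫_Ω μ|𝕊u|², where 𝕊u = ∇u + ∇uᵀ. -/

import Mathlib

/-!
STATEMENT 14: For every divergence-free u ∈ H¹(Ω)³,
∫_Ω gρ₀'|u₃|² ≤ ∫_Γ gρ₊|u₃|² + Λ²∫_Ω ρ₀|u|² + (Λ/2)∫_Ω μ|𝕊u|²,
where Λ = sup_𝐤 λ₁(𝐤) is the supremum over nonzero lattice frequencies of the largest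
characteristic values of the eigenvalue problem.
-/

open MeasureTheory Real Set Filter

noncomputable section

def pd (i : Fin 3) (f : (Fin 3 → ℝ) → ℝ) (x : Fin 3 → ℝ) : ℝ :=
  fderiv ℝ f x (Pi.single i 1)

def cell (L₁ L₂ : ℝ) : Set (Fin 3 → ℝ) :=
  {x | x 0 ∈ Ioo 0 (2 * π * L₁) ∧ x 1 ∈ Ioo 0 (2 * π * L₂) ∧ x 2 < 0}

def cellΓ (L₁ L₂ : ℝ) : Set (ℝ × ℝ) := Ioo 0 (2 * π * L₁) ×ˢ Ioo 0 (2 * π * L₂)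

def Periodic3 (L₁ L₂ : ℝ) (f : (Fin 3 → ℝ) → ℝ) : Prop :=
  ∀ x, f (x + Pi.single 0 (2 * π * L₁)) = f x ∧ f (x + Pi.single 1 (2 * π * L₂)) = f x

/-- a characteristic value `lam` of the eigenvalue problem at wave number `k`:
there is a nontrivial solution `φ ∈ H⁴(ℝ₋)` of the fourth-order ODE with the
boundary conditions at `x₃ = 0` and decay at `-∞` -/
def IsCharValue (μ g k ρp : ℝ) (ρ₀ : ℝ → ℝ) (lam : ℝ) : Prop :=
  0 < lam ∧
  ∃ φ : ℝ → ℝ,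
    ContDiff ℝ 4 φ ∧
    (∀ n ≤ 4, Integrable (fun x => (iteratedDeriv n φ x) ^ 2)
        (volume.restrict (Iio (0 : ℝ)))) ∧
    (∀ x < (0 : ℝ),
      lam ^ 2 * (k ^ 2 * ρ₀ x * φ x - deriv (fun y => ρ₀ y * deriv φ y) x)
        + lam * μ * (iteratedDeriv 4 φ x - 2 * k ^ 2 * iteratedDeriv 2 φ x + k ^ 4 * φ x)
        = g * k ^ 2 * deriv ρ₀ x * φ x) ∧
    (μ * (k ^ 2 * φ 0 + iteratedDeriv 2 φ 0) = 0) ∧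
    (-(lam * μ) * iteratedDeriv 3 φ 0
        + (3 * lam * μ * k ^ 2 + lam ^ 2 * ρp) * deriv φ 0 + g * k ^ 2 * ρp * φ 0 = 0) ∧
    Tendsto φ atBot (nhds 0) ∧
    (∃ x ≤ (0 : ℝ), φ x ≠ 0)

/-- A twice continuously differentiable profile on the closed half line `(-∞, 0]` that is square
integrable together with its first two derivatives. -/
structure Profile where
  f : ℝ → ℝ
  f1 : ℝ → ℝ
  f2 : ℝ → ℝ
  c0 : Continuous f
  c1 : Continuous f1
  c2 : Continuous f2
  d0 : ∀ x < 0, HasDerivAt f (f1 x) x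
  d1 : ∀ x < 0, HasDerivAt f1 (f2 x) x
  i0 : IntegrableOn (fun x => f x ^ 2) (Iio 0)
  i1 : IntegrableOn (fun x => f1 x ^ 2) (Iio 0)
  i2 : IntegrableOn (fun x => f2 x ^ 2) (Iio 0)

lemma integrableOn_mul_of_sq {f g : ℝ → ℝ} {s : Set ℝ} (hf : Continuous f) (hg : Continuous g)
    (hf2 : IntegrableOn (fun x => f x ^ 2) s) (hg2 : IntegrableOn (fun x => g x ^ 2) s) :
    IntegrableOn (fun x => f x * g x) s := by
  refine Integrable.mono' (hf2.add hg2) (hf.mul hg).aestronglyMeasurable (ae_of_all _ fun x => ?_)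
  simp only [Pi.add_apply, norm_mul, Real.norm_eq_abs]
  nlinarith [sq_nonneg (|f x| - |g x|), sq_abs (f x), sq_abs (g x), abs_nonneg (f x),
    abs_nonneg (g x)]

lemma integrableOn_sq_add {f g : ℝ → ℝ} {s : Set ℝ} (hf : Continuous f) (hg : Continuous g)
    (hf2 : IntegrableOn (fun x => f x ^ 2) s) (hg2 : IntegrableOn (fun x => g x ^ 2) s) (t : ℝ) :
    IntegrableOn (fun x => (f x + t * g x) ^ 2) s := by
  have h := integrableOn_mul_of_sq hf hg hf2 hg2
  have : (fun x => (f x + t * g x) ^ 2)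
      = fun x => f x ^ 2 + (2 * t) * (f x * g x) + t ^ 2 * g x ^ 2 := by
    funext x; ring
  rw [this]
  exact (hf2.add (h.const_mul _)).add (hg2.const_mul _)

lemma integrableOn_bdd_mul {w f : ℝ → ℝ} {s : Set ℝ} {K : ℝ} (hw : Continuous w)
    (hK : ∀ x, |w x| ≤ K) (hf : IntegrableOn f s) :
    IntegrableOn (fun x => w x * f x) s :=
  Integrable.bdd_mul hf hw.aestronglyMeasurable (ae_of_all _ fun x => by
    rw [Real.norm_eq_abs]; exact hK x)

namespace Profile

/-- The profile `p + t q`. -/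
def addSmul (p q : Profile) (t : ℝ) : Profile where
  f x := p.f x + t * q.f x
  f1 x := p.f1 x + t * q.f1 x
  f2 x := p.f2 x + t * q.f2 x
  c0 := p.c0.add (continuous_const.mul q.c0)
  c1 := p.c1.add (continuous_const.mul q.c1)
  c2 := p.c2.add (continuous_const.mul q.c2)
  d0 x hx := (p.d0 x hx).add ((q.d0 x hx).const_mul t)
  d1 x hx := (p.d1 x hx).add ((q.d1 x hx).const_mul t)
  i0 := integrableOn_sq_add p.c0 q.c0 p.i0 q.i0 t
  i1 := integrableOn_sq_add p.c1 q.c1 p.i1 q.i1 t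
  i2 := integrableOn_sq_add p.c2 q.c2 p.i2 q.i2 t

lemma sq_le_of_hasDerivAt {f f1 : ℝ → ℝ} (c0 : Continuous f) (c1 : Continuous f1)
    (d0 : ∀ x < 0, HasDerivAt f (f1 x) x)
    (i0 : IntegrableOn (fun x => f x ^ 2) (Iio 0)) (i1 : IntegrableOn (fun x => f1 x ^ 2) (Iio 0)) :
    Tendsto (fun x => f x ^ 2) atBot (nhds 0) ∧
    ∀ x ≤ 0, f x ^ 2 ≤ (∫ x in Iio 0, f x ^ 2) + ∫ x in Iio 0, f1 x ^ 2 := by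
  have hm := integrableOn_mul_of_sq c0 c1 i0 i1
  have hd : ∀ x < 0, HasDerivAt (fun x => f x ^ 2) (2 * (f x * f1 x)) x := fun x hx => by
    refine ((d0 x hx).fun_pow 2).congr_deriv ?_
    simp only [Nat.cast_ofNat, Nat.add_one_sub_one, pow_one]
    ring
  have ht : Tendsto (fun x => f x ^ 2) atBot (nhds 0) := by
    refine tendsto_zero_of_hasDerivAt_of_integrableOn_Iic (a := -1)
      (f' := fun x => 2 * (f x * f1 x)) (fun x hx => hd x ?_) ?_ ?_
    · have : x ≤ -1 := hx
      linarith
    · exact (hm.mono_set (Iic_subset_Iio.2 (by norm_num))).const_mul 2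
    · exact i0.mono_set (Iic_subset_Iio.2 (by norm_num))
  refine ⟨ht, fun x hx => ?_⟩
  have hsub : Iic x ≤ᵐ[volume] Iio (0:ℝ) := by
    have h1 : Iic x ⊆ Iic (0:ℝ) := Iic_subset_Iic.2 hx
    exact h1.eventuallyLE.trans Iio_ae_eq_Iic.symm.le
  have key := integral_Iic_of_hasDerivAt_of_tendsto (a := x) (f := fun x => f x ^ 2)
    (f' := fun x => 2 * (f x * f1 x)) (c0.pow 2).continuousWithinAt
    (fun y hy => hd y (lt_of_lt_of_le hy hx)) ((hm.mono_set_ae hsub).const_mul 2) ht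
  rw [sub_zero] at key
  rw [← key, ← integral_add i0 i1]
  refine (setIntegral_mono (g := fun x => f x ^ 2 + f1 x ^ 2) ((hm.mono_set_ae hsub).const_mul 2)
    ((i0.add i1).mono_set_ae hsub) fun y => ?_).trans ?_
  · nlinarith [sq_nonneg (f y - f1 y)]
  · exact setIntegral_mono_set (i0.add i1) (ae_of_all _ fun y => by positivity) hsub

/-- The squared `H²` norm of a profile. -/
def normSq (p : Profile) : ℝ :=
  (∫ x in Iio 0, p.f x ^ 2) + (∫ x in Iio 0, p.f1 x ^ 2) + ∫ x in Iio 0, p.f2 x ^ 2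

lemma f_sq_le (p : Profile) {x : ℝ} (hx : x ≤ 0) : p.f x ^ 2 ≤ p.normSq := by
  have h := (sq_le_of_hasDerivAt p.c0 p.c1 p.d0 p.i0 p.i1).2 x hx
  have : 0 ≤ ∫ x in Iio 0, p.f2 x ^ 2 := integral_nonneg fun x => by positivity
  unfold normSq; linarith

lemma f1_sq_le (p : Profile) {x : ℝ} (hx : x ≤ 0) : p.f1 x ^ 2 ≤ p.normSq := by
  have h := (sq_le_of_hasDerivAt p.c1 p.c2 p.d1 p.i1 p.i2).2 x hx
  have : 0 ≤ ∫ x in Iio 0, p.f x ^ 2 := integral_nonneg fun x => by positivity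
  unfold normSq; linarith

end Profile

/-- The data of the vertical eigenvalue problem at a fixed wave number `k`; `r` is the derivative
of the density `ρ`. -/
structure Medium where
  (k μ g ρm ρp a M : ℝ)
  (ρ r : ℝ → ℝ)
  k_pos : 0 < k
  μ_pos : 0 < μ
  g_pos : 0 < g
  ρm_pos : 0 < ρm
  r_cont : Continuous r
  hasDeriv : ∀ x, HasDerivAt ρ (r x) x
  r_nonneg : ∀ x, 0 ≤ r x
  r_le : ∀ x, r x ≤ M
  r_zero : ∀ x < -a, r x = 0
  ρm_le : ∀ x, ρm ≤ ρ x
  le_ρp : ∀ x, ρ x ≤ ρp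
  ρ_zero : ρ 0 = ρp

namespace Medium

variable (m : Medium)

lemma ρ_cont : Continuous m.ρ :=
  continuous_iff_continuousAt.2 fun x => (m.hasDeriv x).continuousAt

lemma ρp_pos : 0 < m.ρp := m.ρm_pos.trans_le ((m.ρm_le 0).trans (m.le_ρp 0))

lemma abs_ρ_le (x : ℝ) : |m.ρ x| ≤ m.ρp := by
  rw [abs_of_nonneg (m.ρm_pos.le.trans (m.ρm_le x))]; exact m.le_ρp x

lemma abs_r_le (x : ℝ) : |m.r x| ≤ m.M := by
  rw [abs_of_nonneg (m.r_nonneg x)]; exact m.r_le x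

/-- Kinetic energy. -/
def A (p : Profile) : ℝ := ∫ x in Iio 0, m.ρ x * (m.k ^ 2 * p.f x ^ 2 + p.f1 x ^ 2)

/-- Viscous dissipation. -/
def B (p : Profile) : ℝ :=
  ∫ x in Iio 0, m.μ * ((p.f2 x + m.k ^ 2 * p.f x) ^ 2 + 4 * m.k ^ 2 * p.f1 x ^ 2)

/-- Surface energy. -/
def D (p : Profile) : ℝ := m.g * m.k ^ 2 * m.ρp * p.f 0 ^ 2

/-- Destabilising buoyancy energy. -/
def C (p : Profile) : ℝ := ∫ x in Iio 0, m.g * m.k ^ 2 * (m.r x * p.f x ^ 2)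

lemma int_A (p : Profile) :
    IntegrableOn (fun x => m.ρ x * (m.k ^ 2 * p.f x ^ 2 + p.f1 x ^ 2)) (Iio 0) :=
  integrableOn_bdd_mul m.ρ_cont m.abs_ρ_le ((p.i0.const_mul _).add p.i1)

lemma int_B (p : Profile) : IntegrableOn (fun x =>
    m.μ * ((p.f2 x + m.k ^ 2 * p.f x) ^ 2 + 4 * m.k ^ 2 * p.f1 x ^ 2)) (Iio 0) :=
  ((integrableOn_sq_add p.c2 p.c0 p.i2 p.i0 _).add (p.i1.const_mul _)).const_mul _

lemma int_C (p : Profile) :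
    IntegrableOn (fun x => m.g * m.k ^ 2 * (m.r x * p.f x ^ 2)) (Iio 0) :=
  (integrableOn_bdd_mul m.r_cont m.abs_r_le p.i0).const_mul _

/-- The symmetric bilinear form whose kernel consists of the eigenfunctions at `lam`. -/
def form (lam : ℝ) (p q : Profile) : ℝ :=
  (∫ x in Iio 0, ((lam ^ 2 * m.k ^ 2 * m.ρ x - m.g * m.k ^ 2 * m.r x) * (p.f x * q.f x)
    + (lam ^ 2 * m.ρ x + 4 * lam * m.μ * m.k ^ 2) * (p.f1 x * q.f1 x)
    + lam * m.μ * ((p.f2 x + m.k ^ 2 * p.f x) * (q.f2 x + m.k ^ 2 * q.f x))))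
    + m.g * m.k ^ 2 * m.ρp * (p.f 0 * q.f 0)

lemma int_form (lam : ℝ) (p q : Profile) : IntegrableOn (fun x =>
    (lam ^ 2 * m.k ^ 2 * m.ρ x - m.g * m.k ^ 2 * m.r x) * (p.f x * q.f x)
    + (lam ^ 2 * m.ρ x + 4 * lam * m.μ * m.k ^ 2) * (p.f1 x * q.f1 x)
    + lam * m.μ * ((p.f2 x + m.k ^ 2 * p.f x) * (q.f2 x + m.k ^ 2 * q.f x))) (Iio 0) := by
  have h0 := integrableOn_mul_of_sq p.c0 q.c0 p.i0 q.i0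
  have h1 := integrableOn_mul_of_sq p.c1 q.c1 p.i1 q.i1
  have h2 := integrableOn_mul_of_sq (p.c2.add (continuous_const.mul p.c0))
    (q.c2.add (continuous_const.mul q.c0)) (integrableOn_sq_add p.c2 p.c0 p.i2 p.i0 (m.k ^ 2))
    (integrableOn_sq_add q.c2 q.c0 q.i2 q.i0 (m.k ^ 2))
  have e0 := integrableOn_bdd_mul m.ρ_cont m.abs_ρ_le h0
  have e0' := integrableOn_bdd_mul m.r_cont m.abs_r_le h0
  have e1 := integrableOn_bdd_mul m.ρ_cont m.abs_ρ_le h1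
  refine ((((e0.const_mul (lam ^ 2 * m.k ^ 2)).sub (e0'.const_mul (m.g * m.k ^ 2))).add
    ((e1.const_mul (lam ^ 2)).add (h1.const_mul (4 * lam * m.μ * m.k ^ 2)))).add
    (h2.const_mul (lam * m.μ))).congr (ae_of_all _ fun x => ?_)
  simp only [Pi.add_apply, Pi.sub_apply, Pi.mul_apply]
  ring

lemma form_self (lam : ℝ) (p : Profile) :
    m.form lam p p = lam ^ 2 * m.A p + lam * m.B p + m.D p - m.C p := by
  have e : (lam ^ 2 * m.A p + lam * m.B p) - m.C p
      = ∫ x in Iio 0, (lam ^ 2 * (m.ρ x * (m.k ^ 2 * p.f x ^ 2 + p.f1 x ^ 2))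
        + lam * (m.μ * ((p.f2 x + m.k ^ 2 * p.f x) ^ 2 + 4 * m.k ^ 2 * p.f1 x ^ 2)))
        - m.g * m.k ^ 2 * (m.r x * p.f x ^ 2) := by
    have h := integral_sub (((m.int_A p).const_mul (lam ^ 2)).add ((m.int_B p).const_mul lam))
      (m.int_C p)
    rw [integral_add' ((m.int_A p).const_mul _) ((m.int_B p).const_mul _),
      integral_const_mul, integral_const_mul] at h
    exact h.symm
  have e2 : lam ^ 2 * m.A p + lam * m.B p + m.D p - m.C p
      = ((lam ^ 2 * m.A p + lam * m.B p) - m.C p) + m.D p := by ring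
  rw [e2, e, form, D]
  congr 1
  · congr 1; funext x; ring
  · ring

lemma form_addSmul (lam : ℝ) (p q : Profile) (t : ℝ) :
    m.form lam (p.addSmul q t) (p.addSmul q t)
      = m.form lam p p + 2 * t * m.form lam p q + t ^ 2 * m.form lam q q := by
  unfold form
  have hp := m.int_form lam p p
  have hq := m.int_form lam q q
  have hpq := m.int_form lam p q
  have e := integral_add (hp.add (hpq.const_mul (2 * t))) (hq.const_mul (t ^ 2))
  simp only [Pi.add_apply] at e
  rw [integral_add hp (hpq.const_mul (2 * t)), integral_const_mul, integral_const_mul] at e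
  rw [mul_add, mul_add]
  have : ∀ a b c d e f : ℝ, a + b + (c + d) + (e + f) = (a + c + e) + (b + d + f) := by
    intros; ring
  rw [this, ← e]
  congr 1
  · congr 1; funext x; simp only [Profile.addSmul]; ring
  · simp only [Profile.addSmul]; ring

lemma A_nonneg (p : Profile) : 0 ≤ m.A p :=
  integral_nonneg fun x => mul_nonneg (m.ρm_pos.le.trans (m.ρm_le x)) (by positivity)

lemma B_nonneg (p : Profile) : 0 ≤ m.B p :=
  integral_nonneg fun x => mul_nonneg m.μ_pos.le (by positivity)

lemma D_nonneg (p : Profile) : 0 ≤ m.D p := by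
  have := m.g_pos; have := m.ρp_pos
  unfold D; positivity

lemma exists_normSq_le (lam : ℝ) (hlam : 0 < lam) :
    ∃ K > 0, ∀ p, p.normSq ≤ K * (lam ^ 2 * m.A p + lam * m.B p + m.D p) := by
  have hk := m.k_pos; have hρ := m.ρm_pos; have hμ := m.μ_pos
  set K1 := (m.ρm * m.k ^ 2)⁻¹ with hK1
  set K2 := m.ρm⁻¹ with hK2
  have bound : ∀ p : Profile, (∫ x in Iio 0, p.f x ^ 2) ≤ K1 * m.A p
      ∧ (∫ x in Iio 0, p.f1 x ^ 2) ≤ K2 * m.A p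
      ∧ (∫ x in Iio 0, p.f2 x ^ 2) ≤ 2 * m.μ⁻¹ * m.B p
        + 2 * m.k ^ 4 * ∫ x in Iio 0, p.f x ^ 2 := by
    intro p
    unfold A B
    refine ⟨?_, ?_, ?_⟩
    · rw [← integral_const_mul]
      refine setIntegral_mono p.i0 ((m.int_A p).const_mul _) fun x => ?_
      have : m.ρm * m.k ^ 2 * p.f x ^ 2 ≤ m.ρ x * (m.k ^ 2 * p.f x ^ 2 + p.f1 x ^ 2) := by
        have h1 := mul_le_mul_of_nonneg_right (m.ρm_le x)
          (by positivity : 0 ≤ m.k ^ 2 * p.f x ^ 2 + p.f1 x ^ 2)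
        nlinarith [mul_nonneg hρ.le (sq_nonneg (p.f1 x))]
      rw [hK1, inv_mul_eq_div, le_div_iff₀ (by positivity)]
      linarith
    · rw [← integral_const_mul]
      refine setIntegral_mono p.i1 ((m.int_A p).const_mul _) fun x => ?_
      have : m.ρm * p.f1 x ^ 2 ≤ m.ρ x * (m.k ^ 2 * p.f x ^ 2 + p.f1 x ^ 2) := by
        have h1 := mul_le_mul_of_nonneg_right (m.ρm_le x)
          (by positivity : 0 ≤ m.k ^ 2 * p.f x ^ 2 + p.f1 x ^ 2)
        have h2 : 0 ≤ m.ρm * (m.k ^ 2 * p.f x ^ 2) := by positivity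
        linarith
      rw [hK2, inv_mul_eq_div, le_div_iff₀ (by positivity)]
      linarith
    · rw [← integral_const_mul, ← integral_const_mul,
        ← integral_add ((m.int_B p).const_mul _) (p.i0.const_mul _)]
      refine setIntegral_mono p.i2 (((m.int_B p).const_mul _).add (p.i0.const_mul _)) fun x => ?_
      have : 2 * m.μ⁻¹ * (m.μ * ((p.f2 x + m.k ^ 2 * p.f x) ^ 2 + 4 * m.k ^ 2 * p.f1 x ^ 2))
          = 2 * ((p.f2 x + m.k ^ 2 * p.f x) ^ 2 + 4 * m.k ^ 2 * p.f1 x ^ 2) := by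
        field_simp
      simp only
      rw [this]
      have h2 : 0 ≤ m.k ^ 2 * p.f1 x ^ 2 := by positivity
      nlinarith [sq_nonneg (p.f2 x + 2 * (m.k ^ 2 * p.f x))]
  refine ⟨(K1 + K2 + 2 * m.k ^ 4 * K1) / lam ^ 2 + 2 * m.μ⁻¹ / lam, by positivity, fun p => ?_⟩
  obtain ⟨h0, h1, h2⟩ := bound p
  have hA := m.A_nonneg p; have hB := m.B_nonneg p; have hD := m.D_nonneg p
  have e : (K1 + K2 + 2 * m.k ^ 4 * K1) * m.A p + 2 * m.μ⁻¹ * m.B p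
      ≤ ((K1 + K2 + 2 * m.k ^ 4 * K1) / lam ^ 2 + 2 * m.μ⁻¹ / lam)
        * (lam ^ 2 * m.A p + lam * m.B p + m.D p) := by
    have : ((K1 + K2 + 2 * m.k ^ 4 * K1) / lam ^ 2 + 2 * m.μ⁻¹ / lam)
        * (lam ^ 2 * m.A p + lam * m.B p + m.D p)
        = (K1 + K2 + 2 * m.k ^ 4 * K1) * m.A p + 2 * m.μ⁻¹ * m.B p
          + ((K1 + K2 + 2 * m.k ^ 4 * K1) / lam ^ 2 * (lam * m.B p + m.D p)
          + 2 * m.μ⁻¹ / lam * (lam ^ 2 * m.A p + m.D p)) := by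
      field_simp; ring
    rw [this]
    have : 0 ≤ (K1 + K2 + 2 * m.k ^ 4 * K1) / lam ^ 2 * (lam * m.B p + m.D p)
          + 2 * m.μ⁻¹ / lam * (lam ^ 2 * m.A p + m.D p) := by positivity
    linarith
  refine le_trans ?_ e
  unfold Profile.normSq
  have h3 := mul_le_mul_of_nonneg_left h0 (by positivity : 0 ≤ 2 * m.k ^ 4)
  linarith

end Medium

namespace Medium

variable (m : Medium)

lemma A_addSmul_self (p : Profile) (s : ℝ) : m.A (p.addSmul p (s - 1)) = s ^ 2 * m.A p := by
  unfold A
  rw [← integral_const_mul]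
  congr 1; funext x; simp only [Profile.addSmul]; ring

lemma B_addSmul_self (p : Profile) (s : ℝ) : m.B (p.addSmul p (s - 1)) = s ^ 2 * m.B p := by
  unfold B
  rw [← integral_const_mul]
  congr 1; funext x; simp only [Profile.addSmul]; ring

lemma C_addSmul_self (p : Profile) (s : ℝ) : m.C (p.addSmul p (s - 1)) = s ^ 2 * m.C p := by
  unfold C
  rw [← integral_const_mul]
  congr 1; funext x; simp only [Profile.addSmul]; ring

lemma D_addSmul_self (p : Profile) (s : ℝ) : m.D (p.addSmul p (s - 1)) = s ^ 2 * m.D p := by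
  simp only [D, Profile.addSmul]; ring

lemma form_nonneg_of_large (lam : ℝ) (h1 : 1 ≤ lam) (h2 : m.g * m.M / m.ρm ≤ lam) (p : Profile) :
    0 ≤ m.form lam p p := by
  have hk := m.k_pos; have hρ := m.ρm_pos; have hg := m.g_pos
  have hle : m.C p ≤ lam ^ 2 * m.A p := by
    unfold A C
    rw [← integral_const_mul]
    refine setIntegral_mono (m.int_C p) ((m.int_A p).const_mul _) fun x => ?_
    have e1 : m.g * m.M ≤ lam ^ 2 * m.ρm := by
      rw [div_le_iff₀ hρ] at h2
      have : lam ≤ lam ^ 2 := by nlinarith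
      exact h2.trans (mul_le_mul_of_nonneg_right this hρ.le)
    have e2 := mul_le_mul_of_nonneg_left (m.r_le x) hg.le
    have e3 := mul_le_mul_of_nonneg_left (m.ρm_le x) (sq_nonneg lam)
    have e4 : m.g * m.r x ≤ lam ^ 2 * m.ρ x := by linarith
    have e5 := mul_le_mul_of_nonneg_right e4 (by positivity : 0 ≤ m.k ^ 2 * p.f x ^ 2)
    have e6 : 0 ≤ lam ^ 2 * (m.ρ x * p.f1 x ^ 2) :=
      mul_nonneg (sq_nonneg _) (mul_nonneg (hρ.le.trans (m.ρm_le x)) (sq_nonneg _))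
    simp only
    linarith
  rw [form_self]
  have := mul_nonneg (zero_le_one.trans h1) (m.B_nonneg p)
  have := m.D_nonneg p
  linarith

/-- If the quadratic form takes a negative value at `Λ`, then at some larger critical parameter it
is nonnegative but admits a normalised minimising sequence for the value zero. -/
lemma exists_critical {Λ : ℝ} (hΛ : 0 < Λ) (p₀ : Profile) (hp₀ : m.form Λ p₀ p₀ < 0) :
    ∃ lam > Λ, (∀ p, 0 ≤ m.form lam p p) ∧ ∃ p : ℕ → Profile,
      (∀ n, m.C (p n) = 1) ∧ Tendsto (fun n => m.form lam (p n) (p n)) atTop (nhds 0) := by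
  set S : Set ℝ := {lam | Λ ≤ lam ∧ ∀ p, 0 ≤ m.form lam p p} with hS
  have hne : S.Nonempty := by
    refine ⟨max Λ (max 1 (m.g * m.M / m.ρm)), le_max_left _ _, fun p => ?_⟩
    exact m.form_nonneg_of_large _ ((le_max_left _ _).trans (le_max_right _ _))
      ((le_max_right _ _).trans (le_max_right _ _)) p
  have hbdd : BddBelow S := ⟨Λ, fun x hx => hx.1⟩
  have hcl : IsClosed S := by
    have : S = Ici Λ ∩ ⋂ p, {lam | 0 ≤ m.form lam p p} := by
      ext x; simp [hS]
    rw [this]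
    refine isClosed_Ici.inter (isClosed_iInter fun p => ?_)
    simp only [form_self]
    exact isClosed_le continuous_const (by fun_prop)
  set lam := sInf S with hlam
  have hmem : lam ∈ S := hcl.csInf_mem hne hbdd
  have hlt : Λ < lam := by
    refine lt_of_le_of_ne hmem.1 fun h => ?_
    have := hmem.2 p₀
    rw [← h] at this
    linarith
  set l : ℕ → ℝ := fun n => lam - (lam - Λ) * (1 / ((n : ℝ) + 1)) with hl
  have hl1 : ∀ n, Λ ≤ l n ∧ l n < lam := by
    intro n
    have h1 : 0 < 1 / ((n : ℝ) + 1) := by positivity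
    have h2 : 1 / ((n : ℝ) + 1) ≤ 1 := by
      rw [div_le_one (by positivity)]; linarith [(Nat.cast_nonneg n : (0:ℝ) ≤ n)]
    have h3 : 0 < lam - Λ := by linarith
    constructor
    · simp only [hl]; nlinarith
    · simp only [hl]; nlinarith
  have hlt : Tendsto l atTop (nhds lam) := by
    have := (tendsto_one_div_add_atTop_nhds_zero_nat (𝕜 := ℝ)).const_mul (lam - Λ)
    simpa [hl] using this.const_sub lam
  have hex : ∀ n, ∃ p : Profile, m.C p = 1 ∧ m.form (l n) p p < 0 := by
    intro n
    have hn : l n ∉ S := fun h => (hl1 n).2.not_ge (csInf_le hbdd h)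
    have : ∃ p, m.form (l n) p p < 0 := by
      by_contra! hcon
      exact hn ⟨(hl1 n).1, hcon⟩
    obtain ⟨p, hp⟩ := this
    rw [form_self] at hp
    have hA := m.A_nonneg p; have hB := m.B_nonneg p; have hD := m.D_nonneg p
    have hln : 0 < l n := hΛ.trans_le (hl1 n).1
    have hC : 0 < m.C p := by
      have : 0 ≤ l n ^ 2 * m.A p + l n * m.B p := by positivity
      linarith
    refine ⟨p.addSmul p ((√(m.C p))⁻¹ - 1), ?_, ?_⟩
    · rw [C_addSmul_self, inv_pow, Real.sq_sqrt hC.le, inv_mul_cancel₀ hC.ne']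
    · rw [form_self, A_addSmul_self, B_addSmul_self, C_addSmul_self, D_addSmul_self, inv_pow,
        Real.sq_sqrt hC.le]
      have := mul_neg_of_pos_of_neg (inv_pos.2 hC) hp
      linarith
  choose p hpC hpQ using hex
  refine ⟨lam, by linarith [(hl1 0).1, (hl1 0).2], hmem.2, p, hpC, ?_⟩
  have hub : ∀ n, m.form lam (p n) (p n)
      ≤ (lam ^ 2 - l n ^ 2) * (Λ ^ 2)⁻¹ + (lam - l n) * Λ⁻¹ := by
    intro n
    have hq := hpQ n
    rw [form_self, hpC] at hq
    rw [form_self, hpC]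
    have hA := m.A_nonneg (p n); have hB := m.B_nonneg (p n); have hD := m.D_nonneg (p n)
    obtain ⟨ha, hb⟩ := hl1 n
    have hsq : Λ ^ 2 ≤ l n ^ 2 := by gcongr
    have hsq' : l n ^ 2 ≤ lam ^ 2 := pow_le_pow_left₀ (hΛ.le.trans ha) hb.le 2
    have hA' := mul_le_mul_of_nonneg_right hsq hA
    have hB' := mul_le_mul_of_nonneg_right ha hB
    have hA0 : 0 ≤ Λ ^ 2 * m.A (p n) := by positivity
    have hB0 : 0 ≤ Λ * m.B (p n) := by positivity
    have hA1 : m.A (p n) ≤ (Λ ^ 2)⁻¹ := by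
      rw [← one_div, le_div_iff₀ (by positivity)]; linarith
    have hB1 : m.B (p n) ≤ Λ⁻¹ := by
      rw [← one_div, le_div_iff₀ (by positivity)]; linarith
    have i1 := mul_le_mul_of_nonneg_left hA1 (sub_nonneg.2 hsq')
    have i2 := mul_le_mul_of_nonneg_left hB1 (sub_nonneg.2 hb.le)
    linarith
  refine squeeze_zero (fun n => hmem.2 (p n)) hub ?_
  have t1 : Tendsto (fun n => (lam ^ 2 - l n ^ 2) * (Λ ^ 2)⁻¹ + (lam - l n) * Λ⁻¹) atTop
      (nhds ((lam ^ 2 - lam ^ 2) * (Λ ^ 2)⁻¹ + (lam - lam) * Λ⁻¹)) :=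
    (((hlt.pow 2).const_sub _).mul_const _).add ((hlt.const_sub _).mul_const _)
  simpa using t1

end Medium

/-- A uniformly bounded sequence of functions with a common Lipschitz constant has a pointwise
convergent subsequence. -/
lemma exists_subseq_tendsto_of_lipschitz (f : ℕ → ℝ → ℝ) (R : ℝ) (hb : ∀ n x, |f n x| ≤ R)
    (hl : ∀ n x y, |f n x - f n y| ≤ R * |x - y|) :
    ∃ s : ℕ → ℕ, StrictMono s ∧
      ∃ F : ℝ → ℝ, ∀ x, Tendsto (fun n => f (s n) x) atTop (nhds (F x)) := by
  have hR : 0 ≤ R := (abs_nonneg _).trans (hb 0 0)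
  have hK : IsCompact (Set.pi Set.univ fun _ : ℚ => Icc (-R) R) :=
    isCompact_univ_pi fun _ => isCompact_Icc
  obtain ⟨F₀, -, s, hs, hF₀⟩ := hK.tendsto_subseq (x := fun n (q : ℚ) => f n q)
    (fun n q _ => abs_le.1 (hb n q))
  rw [tendsto_pi_nhds] at hF₀
  have hc : ∀ x, CauchySeq fun n => f (s n) x := by
    intro x
    rw [Metric.cauchySeq_iff']
    intro ε hε
    obtain ⟨q, hq1, hq2⟩ := exists_rat_btwn (show x < x + ε / (4 * (R + 1)) by
      have : 0 < ε / (4 * (R + 1)) := by positivity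
      linarith)
    obtain ⟨N, hN⟩ := Metric.cauchySeq_iff'.1 (hF₀ q).cauchySeq (ε / 4) (by positivity)
    refine ⟨N, fun n hn => ?_⟩
    have h1 := hN n hn
    simp only [Function.comp_apply, Real.dist_eq] at h1
    rw [Real.dist_eq]
    have hxq : R * |x - q| ≤ ε / 4 := by
      have : |x - q| ≤ ε / (4 * (R + 1)) := by
        rw [abs_sub_comm, abs_of_pos (by linarith)]; linarith
      calc R * |x - q| ≤ (R + 1) * (ε / (4 * (R + 1))) := by gcongr; linarith
        _ = ε / 4 := by field_simp
    have h2 := abs_lt.1 h1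
    have h3 := abs_le.1 ((hl (s n) x q).trans hxq)
    have h4 := abs_le.1 ((hl (s N) x q).trans hxq)
    rw [abs_lt]
    constructor <;> linarith [h2.1, h2.2, h3.1, h3.2, h4.1, h4.2]
  choose F hF using fun x => cauchySeq_tendsto_of_complete (hc x)
  exact ⟨s, hs, F, hF⟩

/-- A quantitative uniform Cauchy condition gives a uniform limit. -/
lemma exists_tendstoUniformly_of_sq_sub_le (f : ℕ → ℝ → ℝ) (e : ℕ → ℝ)
    (he : Tendsto e atTop (nhds 0)) (h : ∀ n m x, (f n x - f m x) ^ 2 ≤ e n + e m) :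
    ∃ F : ℝ → ℝ, TendstoUniformly f F atTop := by
  have hU : UniformCauchySeqOn f atTop Set.univ := by
    rw [Metric.uniformCauchySeqOn_iff]
    intro ε hε
    have h2 : ∀ᶠ n in atTop, e n < ε ^ 2 / 2 := he.eventually (gt_mem_nhds (by positivity))
    obtain ⟨N, hN⟩ := eventually_atTop.1 h2
    refine ⟨N, fun a ha b hb x _ => ?_⟩
    rw [Real.dist_eq]
    refine abs_lt_of_sq_lt_sq ?_ hε.le
    linarith [h a b x, hN a ha, hN b hb]
  choose F hF using fun x => cauchySeq_tendsto_of_complete (hU.cauchySeq (mem_univ x))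
  exact ⟨F, tendstoUniformlyOn_univ.1 (hU.tendstoUniformlyOn_of_tendsto fun x _ => hF x)⟩

namespace Medium

variable (m : Medium)

lemma integrableOn_r : IntegrableOn m.r (Iio 0) := by
  have h1 : IntegrableOn m.r (Icc (-m.a) 0) := m.r_cont.continuousOn.integrableOn_Icc
  refine h1.of_forall_sdiff_eq_zero measurableSet_Iio fun x hx => m.r_zero x ?_
  by_contra! h
  exact hx.2 ⟨h, le_of_lt hx.1⟩

lemma normSq_bounded {lam : ℝ} (hlam : 0 < lam) (p : ℕ → Profile) (hC : ∀ n, m.C (p n) = 1)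
    (hQ : Tendsto (fun n => m.form lam (p n) (p n)) atTop (nhds 0)) :
    ∃ R, ∀ n, (p n).normSq ≤ R := by
  obtain ⟨K, hK, hle⟩ := m.exists_normSq_le lam hlam
  obtain ⟨R, hR⟩ := hQ.bddAbove_range
  refine ⟨K * (R + 1), fun n => (hle _).trans (mul_le_mul_of_nonneg_left ?_ hK.le)⟩
  have := hR (mem_range_self n)
  simp only [form_self, hC] at this
  linarith

lemma tendsto_C {p : ℕ → Profile} {R : ℝ} (hR : ∀ n, (p n).normSq ≤ R) {F : ℝ → ℝ}
    (hF : ∀ x ≤ 0, Tendsto (fun n => (p n).f x) atTop (nhds (F x))) (G : ℝ → ℝ)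
    (hGc : Continuous G)
    (hG : ∀ x ≤ 0, G x ^ 2 ≤ R) :
    Tendsto (fun n => ∫ x in Iio 0, m.r x * ((p n).f x - G x) ^ 2) atTop
      (nhds (∫ x in Iio 0, m.r x * (F x - G x) ^ 2)) := by
  refine tendsto_integral_of_dominated_convergence (fun x => m.r x * (4 * R)) (fun n => ?_)
    (m.integrableOn_r.mul_const _) (fun n => ?_) ?_
  · exact (m.r_cont.mul (((p n).c0.sub hGc).pow 2)).aestronglyMeasurable
  · refine (ae_restrict_iff' measurableSet_Iio).2 (ae_of_all _ fun x hx => ?_)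
    rw [Real.norm_eq_abs, abs_of_nonneg (mul_nonneg (m.r_nonneg x) (sq_nonneg _))]
    refine mul_le_mul_of_nonneg_left ?_ (m.r_nonneg x)
    have h1 := (p n).f_sq_le (le_of_lt hx)
    have h2 := hG x (le_of_lt hx)
    nlinarith [hR n, sq_nonneg ((p n).f x + G x)]
  · refine (ae_restrict_iff' measurableSet_Iio).2 (ae_of_all _ fun x hx => ?_)
    exact (((hF x (le_of_lt hx)).sub_const _).pow 2).const_mul _

end Medium

/-- Fundamental theorem of calculus on the closed half line. -/
lemma integral_eq_sub_of_neg {f f1 : ℝ → ℝ} (hf : Continuous f) (hf1 : Continuous f1)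
    (hd : ∀ x < 0, HasDerivAt f (f1 x) x) {x y : ℝ} (hxy : x ≤ y) (hy : y ≤ 0) :
    ∫ t in x..y, f1 t = f y - f x :=
  intervalIntegral.integral_eq_sub_of_hasDerivAt_of_le hxy hf.continuousOn
    (fun t ht => hd t (ht.2.trans_le hy)) (hf1.intervalIntegrable _ _)

lemma abs_sub_min_le {f f1 : ℝ → ℝ} (hf : Continuous f) (hf1 : Continuous f1)
    (hd : ∀ x < 0, HasDerivAt f (f1 x) x) {R : ℝ} (hR : ∀ x ≤ 0, |f1 x| ≤ R) (x y : ℝ) :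
    |f (min x 0) - f (min y 0)| ≤ R * |x - y| := by
  have hR0 : 0 ≤ R := (abs_nonneg _).trans (hR 0 le_rfl)
  have key : ∀ x y : ℝ, x ≤ y → |f (min x 0) - f (min y 0)| ≤ R * |x - y| := by
    intro x y hxy
    have hm : min x 0 ≤ min y 0 := min_le_min_right 0 hxy
    have h := intervalIntegral.norm_integral_le_of_norm_le_const (a := min x 0) (b := min y 0)
      (f := f1) (C := R) (fun t ht => by
        rw [uIoc_of_le hm] at ht
        exact hR t (ht.2.trans (min_le_right _ _)))
    rw [integral_eq_sub_of_neg hf hf1 hd hm (min_le_right _ _), Real.norm_eq_abs] at h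
    rw [abs_sub_comm]
    refine h.trans (mul_le_mul_of_nonneg_left ?_ hR0)
    rw [abs_sub_comm x y]
    exact abs_min_sub_min_le_max y 0 x 0 |>.trans (by simp)
  rcases le_total x y with h | h
  · exact key x y h
  · rw [abs_sub_comm, abs_sub_comm x y]; exact key y x h

namespace Medium

variable (m : Medium)

lemma integrableOn_r_mul_sq {h : ℝ → ℝ} (hc : Continuous h) {R : ℝ} (hR : ∀ x ≤ 0, h x ^ 2 ≤ R) :
    IntegrableOn (fun x => m.r x * h x ^ 2) (Iio 0) := by
  refine Integrable.mono' (m.integrableOn_r.mul_const R)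
    (m.r_cont.mul (hc.pow 2)).aestronglyMeasurable
    ((ae_restrict_iff' measurableSet_Iio).2 (ae_of_all _ fun x hx => ?_))
  rw [Real.norm_eq_abs, abs_of_nonneg (mul_nonneg (m.r_nonneg x) (sq_nonneg _))]
  exact mul_le_mul_of_nonneg_left (hR x (le_of_lt hx)) (m.r_nonneg x)

/-- A minimising sequence converges, in `C¹` and boundedly, along a subsequence. -/
lemma exists_limit {lam : ℝ} (hlam : 0 < lam) (hpos : ∀ p, 0 ≤ m.form lam p p)
    (p : ℕ → Profile) (hC : ∀ n, m.C (p n) = 1)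
    (hQ : Tendsto (fun n => m.form lam (p n) (p n)) atTop (nhds 0)) :
    ∃ s : ℕ → ℕ, StrictMono s ∧ ∃ F F1 : ℝ → ℝ, Continuous F ∧ Continuous F1 ∧
      (∀ x < 0, HasDerivAt F (F1 x) x) ∧
      (∀ x ≤ 0, Tendsto (fun n => (p (s n)).f x) atTop (nhds (F x))) ∧
      (∀ x ≤ 0, Tendsto (fun n => (p (s n)).f1 x) atTop (nhds (F1 x))) ∧
      ∃ x ≤ 0, F x ≠ 0 := by
  obtain ⟨R, hR⟩ := m.normSq_bounded hlam p hC hQ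
  have hf : ∀ n, ∀ x ≤ 0, |(p n).f x| ≤ √R := fun n x hx =>
    Real.abs_le_sqrt (((p n).f_sq_le hx).trans (hR n))
  have hf1 : ∀ n, ∀ x ≤ 0, |(p n).f1 x| ≤ √R := fun n x hx =>
    Real.abs_le_sqrt (((p n).f1_sq_le hx).trans (hR n))
  obtain ⟨s, hs, F₀, hF₀⟩ := exists_subseq_tendsto_of_lipschitz
    (fun n x => (p n).f (min x 0)) (√R) (fun n x => hf n _ (min_le_right _ _))
    (fun n x y => abs_sub_min_le (p n).c0 (p n).c1 (p n).d0 (hf1 n) x y)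
  have hF₀c : Continuous F₀ := by
    have : LipschitzWith (Real.toNNReal √R) F₀ := by
      refine LipschitzWith.of_dist_le_mul fun x y => ?_
      rw [Real.dist_eq, Real.dist_eq, Real.coe_toNNReal _ (Real.sqrt_nonneg _)]
      exact le_of_tendsto (((hF₀ x).sub (hF₀ y)).abs) (Eventually.of_forall fun n =>
        abs_sub_min_le (p (s n)).c0 (p (s n)).c1 (p (s n)).d0 (hf1 (s n)) x y)
    exact this.continuous
  have hF₀' : ∀ x ≤ 0, Tendsto (fun n => (p (s n)).f x) atTop (nhds (F₀ x)) := fun x hx => by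
    simpa [min_eq_left hx] using hF₀ x
  have hF₀R : ∀ x ≤ 0, F₀ x ^ 2 ≤ R := fun x hx =>
    le_of_tendsto ((hF₀' x hx).pow 2) (Eventually.of_forall fun n =>
      ((p (s n)).f_sq_le hx).trans (hR _))
  set e : ℕ → ℝ := fun n => ∫ x in Iio 0, m.r x * ((p (s n)).f x - F₀ x) ^ 2 with he
  have he0 : Tendsto e atTop (nhds 0) := by
    simpa using m.tendsto_C (fun n => hR (s n)) hF₀' F₀ hF₀c hF₀R
  have hint : ∀ n, IntegrableOn (fun x => m.r x * ((p (s n)).f x - F₀ x) ^ 2) (Iio 0) := fun n =>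
    m.integrableOn_r_mul_sq ((p (s n)).c0.sub hF₀c) (R := 4 * R) fun x hx => by
      nlinarith [hF₀R x hx, ((p (s n)).f_sq_le hx).trans (hR _), sq_nonneg ((p (s n)).f x + F₀ x)]
  obtain ⟨K, hK, hcoer⟩ := m.exists_normSq_le lam hlam
  set δ : ℕ → ℝ := fun n => K * (2 * m.form lam (p (s n)) (p (s n)) + m.g * m.k ^ 2 * (2 * e n))
    with hδ
  have hδ0 : Tendsto δ atTop (nhds 0) := by
    have := (((hQ.comp hs.tendsto_atTop).const_mul 2).add
      ((he0.const_mul 2).const_mul (m.g * m.k ^ 2))).const_mul K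
    simpa [hδ] using this
  have hdiff : ∀ i j, ((p (s i)).addSmul (p (s j)) (-1)).normSq ≤ δ i + δ j := by
    intro i j
    set q := (p (s i)).addSmul (p (s j)) (-1) with hq
    have h1 := m.form_addSmul lam (p (s i)) (p (s j)) (-1)
    have h2 := m.form_addSmul lam (p (s i)) (p (s j)) 1
    have h3 := hpos ((p (s i)).addSmul (p (s j)) 1)
    have h4 : m.form lam q q ≤ 2 * m.form lam (p (s i)) (p (s i))
        + 2 * m.form lam (p (s j)) (p (s j)) := by rw [hq]; linarith
    have h5 : m.C q ≤ m.g * m.k ^ 2 * (2 * e i + 2 * e j) := by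
      unfold C
      have hsum := integral_add ((hint i).const_mul 2) ((hint j).const_mul 2)
      rw [integral_const_mul, integral_const_mul] at hsum
      rw [integral_const_mul, ← hsum]
      refine mul_le_mul_of_nonneg_left ?_ (mul_nonneg m.g_pos.le (sq_nonneg _))
      refine setIntegral_mono (integrableOn_bdd_mul m.r_cont m.abs_r_le q.i0)
        (((hint i).const_mul 2).add ((hint j).const_mul 2)) fun x => ?_
      have := m.r_nonneg x
      have e1 : q.f x = ((p (s i)).f x - F₀ x) - ((p (s j)).f x - F₀ x) := by
        simp only [hq, Profile.addSmul]; ring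
      simp only
      rw [e1]
      nlinarith [mul_nonneg this (sq_nonneg (((p (s i)).f x - F₀ x) + ((p (s j)).f x - F₀ x)))]
    have h6 := hcoer q
    have h7 := m.form_self lam q
    have h8 : lam ^ 2 * m.A q + lam * m.B q + m.D q ≤
        (2 * m.form lam (p (s i)) (p (s i)) + m.g * m.k ^ 2 * (2 * e i))
        + (2 * m.form lam (p (s j)) (p (s j)) + m.g * m.k ^ 2 * (2 * e j)) := by linarith
    have h9 := mul_le_mul_of_nonneg_left h8 hK.le
    simp only [hδ]
    linarith
  obtain ⟨F, hF⟩ := exists_tendstoUniformly_of_sq_sub_le (fun n x => (p (s n)).f (min x 0)) δ hδ0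
    (fun i j x => by
      have := (((p (s i)).addSmul (p (s j)) (-1)).f_sq_le (min_le_right x 0)).trans (hdiff i j)
      simpa [Profile.addSmul, ← sub_eq_add_neg] using this)
  obtain ⟨F1, hF1⟩ := exists_tendstoUniformly_of_sq_sub_le (fun n x => (p (s n)).f1 (min x 0)) δ hδ0
    (fun i j x => by
      have := (((p (s i)).addSmul (p (s j)) (-1)).f1_sq_le (min_le_right x 0)).trans (hdiff i j)
      simpa [Profile.addSmul, ← sub_eq_add_neg] using this)
  have hFx : ∀ x ≤ 0, Tendsto (fun n => (p (s n)).f x) atTop (nhds (F x)) := fun x hx => by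
    simpa [min_eq_left hx] using hF.tendsto_at x
  have hF1x : ∀ x ≤ 0, Tendsto (fun n => (p (s n)).f1 x) atTop (nhds (F1 x)) := fun x hx => by
    simpa [min_eq_left hx] using hF1.tendsto_at x
  have hmin : Continuous fun x : ℝ => min x 0 := continuous_id.min continuous_const
  refine ⟨s, hs, F, F1, hF.continuous (Frequently.of_forall fun n => (p (s n)).c0.comp hmin),
    hF1.continuous (Frequently.of_forall fun n => (p (s n)).c1.comp hmin), fun x hx => ?_, hFx,
    hF1x, ?_⟩
  · refine hasDerivAt_of_tendstoUniformlyOn (l := atTop) (f := fun n => (p (s n)).f)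
      (f' := fun n x => (p (s n)).f1 (min x 0)) isOpen_Iio
      (hF1.tendstoUniformlyOn) (Eventually.of_forall fun n y hy => ?_)
      (fun y hy => hFx y (le_of_lt hy)) hx
    rw [min_eq_left (le_of_lt hy)]
    exact (p (s n)).d0 y hy
  · by_contra! h0
    have h1 := m.tendsto_C (fun n => hR (s n)) hFx 0 continuous_const (fun x hx => by
      simpa using (sq_nonneg (F₀ 0)).trans (hF₀R 0 le_rfl))
    have h2 : (∫ x in Iio 0, m.r x * (F x - (0 : ℝ → ℝ) x) ^ 2) = 0 := by
      refine setIntegral_eq_zero_of_forall_eq_zero fun x hx => ?_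
      rw [h0 x (le_of_lt hx)]; simp
    rw [h2] at h1
    have h3 : ∀ n, (∫ x in Iio 0, m.r x * ((p (s n)).f x - (0 : ℝ → ℝ) x) ^ 2)
        = (m.g * m.k ^ 2)⁻¹ := by
      intro n
      have := hC (s n)
      unfold C at this
      rw [integral_const_mul] at this
      simp only [Pi.zero_apply, sub_zero]
      exact eq_inv_of_mul_eq_one_right this
    simp only [h3] at h1
    have h4 := tendsto_nhds_unique h1 tendsto_const_nhds
    have := m.g_pos; have := m.k_pos
    have : 0 < (m.g * m.k ^ 2)⁻¹ := by positivity
    linarith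

end Medium

lemma hasDerivAt_max_zero_pow (n : ℕ) (y : ℝ) :
    HasDerivAt (fun y : ℝ => max y 0 ^ (n + 2)) ((n + 2) * max y 0 ^ (n + 1)) y := by
  have hpow : HasDerivAt (fun y : ℝ => y ^ (n + 2)) ((n + 2) * y ^ (n + 1)) y := by
    simpa using hasDerivAt_pow (n + 2) y
  rcases lt_trichotomy y 0 with hy | hy | hy
  · rw [max_eq_right hy.le, zero_pow (Nat.succ_ne_zero _), mul_zero]
    refine (hasDerivAt_const y (0 : ℝ)).congr_of_eventuallyEq ?_
    filter_upwards [gt_mem_nhds hy] with z hz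
    rw [max_eq_right hz.le, zero_pow (by omega)]
  · subst hy
    rw [max_self, zero_pow (Nat.succ_ne_zero _), mul_zero] at *
    rw [← hasDerivWithinAt_univ, ← Iic_union_Ici (a := (0 : ℝ))]
    refine HasDerivWithinAt.union ?_ ?_
    · refine (hasDerivWithinAt_const (0 : ℝ) _ (0 : ℝ)).congr (fun z hz => ?_) ?_
      · rw [max_eq_right hz, zero_pow (by omega)]
      · rw [max_self, zero_pow (by omega)]
    · refine hpow.hasDerivWithinAt.congr (fun z hz => ?_) ?_
      · rw [max_eq_left hz]
      · rw [max_self]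
  · rw [max_eq_left hy.le]
    refine hpow.congr_of_eventuallyEq ?_
    filter_upwards [lt_mem_nhds hy] with z hz
    rw [max_eq_left (le_of_lt hz)]

lemma integrableOn_Iio_of_zero_left {h : ℝ → ℝ} (hc : Continuous h) {x : ℝ}
    (hz : ∀ t ≤ x, h t = 0) : IntegrableOn h (Iio 0) := by
  have h1 : IntegrableOn h (Icc x 0) := hc.continuousOn.integrableOn_Icc
  refine h1.of_forall_sdiff_eq_zero measurableSet_Iio fun t ht => hz t ?_
  by_contra! hlt
  exact ht.2 ⟨hlt.le, le_of_lt ht.1⟩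

lemma setIntegral_Iio_of_zero_left {h : ℝ → ℝ} {x : ℝ} (hx : x ≤ 0)
    (hz : ∀ t ≤ x, h t = 0) : ∫ t in Iio 0, h t = ∫ t in x..0, h t := by
  rw [intervalIntegral.integral_of_le hx, integral_Ioc_eq_integral_Ioo]
  refine setIntegral_eq_of_subset_of_forall_sdiff_eq_zero measurableSet_Iio
    (fun t ht => ht.2) fun t ht => hz t ?_
  by_contra! hlt
  exact ht.2 ⟨hlt, ht.1⟩

/-- The cubic test profile `t ↦ (t - x)₊³ / 6`. -/
def Profile.cubic (x : ℝ) : Profile where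
  f t := max (t - x) 0 ^ 3 / 6
  f1 t := max (t - x) 0 ^ 2 / 2
  f2 t := max (t - x) 0
  c0 := by fun_prop
  c1 := by fun_prop
  c2 := by fun_prop
  d0 t _ := by
    refine (((hasDerivAt_max_zero_pow 1 (t - x)).comp t
      ((hasDerivAt_id t).sub_const x)).div_const 6).congr_deriv ?_
    norm_num; ring
  d1 t _ := by
    refine (((hasDerivAt_max_zero_pow 0 (t - x)).comp t
      ((hasDerivAt_id t).sub_const x)).div_const 2).congr_deriv ?_
    norm_num
  i0 := integrableOn_Iio_of_zero_left (x := x) (by fun_prop) fun t ht => by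
    rw [max_eq_right (sub_nonpos.2 ht)]; norm_num
  i1 := integrableOn_Iio_of_zero_left (x := x) (by fun_prop) fun t ht => by
    rw [max_eq_right (sub_nonpos.2 ht)]; norm_num
  i2 := integrableOn_Iio_of_zero_left (x := x) (by fun_prop) fun t ht => by
    rw [max_eq_right (sub_nonpos.2 ht)]; norm_num

/-- Bounded convergence on a compact interval `[x, 0]`. -/
lemma tendsto_integral_mul_of_bounded {f : ℕ → ℝ → ℝ} {F α : ℝ → ℝ} (hα : Continuous α)
    (hf : ∀ n, Continuous (f n)) {R : ℝ} (hR : ∀ n, ∀ x ≤ 0, |f n x| ≤ R)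
    (hF : ∀ x ≤ 0, Tendsto (fun n => f n x) atTop (nhds (F x))) {x : ℝ} (hx : x ≤ 0) :
    Tendsto (fun n => ∫ t in x..0, α t * f n t) atTop (nhds (∫ t in x..0, α t * F t)) := by
  refine intervalIntegral.tendsto_integral_filter_of_dominated_convergence (fun t => |α t| * R)
    (Eventually.of_forall fun n => (hα.mul (hf n)).aestronglyMeasurable)
    (Eventually.of_forall fun n => ae_of_all _ fun t ht => ?_)
    ((hα.abs.mul continuous_const).intervalIntegrable _ _) (ae_of_all _ fun t ht => ?_)
  · rw [uIoc_of_le hx] at ht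
    rw [norm_mul, Real.norm_eq_abs, Real.norm_eq_abs]
    exact mul_le_mul_of_nonneg_left (hR n t ht.2) (abs_nonneg _)
  · rw [uIoc_of_le hx] at ht
    exact (hF t ht.2).const_mul _

namespace Medium

variable (m : Medium)

lemma form_sq_le {lam : ℝ} (hpos : ∀ p, 0 ≤ m.form lam p p) (p q : Profile) :
    m.form lam p q ^ 2 ≤ m.form lam p p * m.form lam q q := by
  have h := discrim_le_zero (a := m.form lam q q) (b := 2 * m.form lam p q)
    (c := m.form lam p p) fun t => by
      have := hpos (p.addSmul q t)
      rw [form_addSmul] at this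
      linarith
  unfold discrim at h
  linarith

lemma tendsto_form_zero {lam : ℝ} (hpos : ∀ p, 0 ≤ m.form lam p p) {p : ℕ → Profile}
    (hQ : Tendsto (fun n => m.form lam (p n) (p n)) atTop (nhds 0)) (q : Profile) :
    Tendsto (fun n => m.form lam (p n) q) atTop (nhds 0) := by
  have h : Tendsto (fun n => √(m.form lam (p n) (p n) * m.form lam q q)) atTop (nhds 0) := by
    have := (hQ.mul_const (m.form lam q q)).sqrt
    simpa using this
  exact squeeze_zero_norm (fun n => Real.abs_le_sqrt (m.form_sq_le hpos _ _)) h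

/-- The form against a cubic test profile, after integration by parts. -/
def weak (lam x : ℝ) (f f1 : ℝ → ℝ) : ℝ :=
  (∫ t in x..0, ((lam ^ 2 * m.k ^ 2 * m.ρ t - m.g * m.k ^ 2 * m.r t + lam * m.μ * m.k ^ 4)
      * ((t - x) ^ 3 / 6) + lam * m.μ * m.k ^ 2 * (t - x)) * f t)
    + (∫ t in x..0, ((lam ^ 2 * m.ρ t + 3 * lam * m.μ * m.k ^ 2) * ((t - x) ^ 2 / 2)) * f1 t)
    + lam * m.μ * (f1 0 * (-x) - f 0 + f x)
    + (lam * m.μ * m.k ^ 2 * f1 0 + m.g * m.k ^ 2 * m.ρp * f 0) * ((-x) ^ 3 / 6)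

lemma form_cubic (lam : ℝ) (p : Profile) {x : ℝ} (hx : x ≤ 0) :
    m.form lam p (Profile.cubic x) = m.weak lam x p.f p.f1 := by
  have hρ := m.ρ_cont
  have hr := m.r_cont
  have h0 := p.c0
  have h1 := p.c1
  have h2 := p.c2
  unfold form weak
  rw [setIntegral_Iio_of_zero_left hx]
  swap
  · intro t ht
    simp only [Profile.cubic]
    rw [max_eq_right (sub_nonpos.2 ht)]; ring
  have e1 : ∫ t in x..0, (lam * m.μ * p.f2 t * ((t - x) + m.k ^ 2 * ((t - x) ^ 3 / 6))
        + lam * m.μ * m.k ^ 2 * p.f1 t * ((t - x) ^ 2 / 2))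
      = lam * m.μ * (p.f1 0 * ((0 - x) + m.k ^ 2 * ((0 - x) ^ 3 / 6)) - p.f 0)
        - lam * m.μ * (p.f1 x * ((x - x) + m.k ^ 2 * ((x - x) ^ 3 / 6)) - p.f x) := by
    refine intervalIntegral.integral_eq_sub_of_hasDerivAt_of_le hx
      (f := fun t => lam * m.μ * (p.f1 t * ((t - x) + m.k ^ 2 * ((t - x) ^ 3 / 6)) - p.f t))
      (by fun_prop) (fun t ht => ?_)
      (Continuous.intervalIntegrable (by fun_prop) _ _)
    have d := (hasDerivAt_id t).sub_const x
    refine ((((p.d1 t ht.2).mul (d.add (((d.fun_pow 3).div_const 6).const_mul (m.k ^ 2)))).sub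
      (p.d0 t ht.2)).const_mul (lam * m.μ)).congr_deriv ?_
    simp only [id_eq, Pi.add_apply]
    norm_num
    ring
  have e2 : ∫ t in x..0, ((lam ^ 2 * m.k ^ 2 * m.ρ t - m.g * m.k ^ 2 * m.r t)
          * (p.f t * (Profile.cubic x).f t)
        + (lam ^ 2 * m.ρ t + 4 * lam * m.μ * m.k ^ 2) * (p.f1 t * (Profile.cubic x).f1 t)
        + lam * m.μ * ((p.f2 t + m.k ^ 2 * p.f t)
          * ((Profile.cubic x).f2 t + m.k ^ 2 * (Profile.cubic x).f t)))
      = (∫ t in x..0, ((lam ^ 2 * m.k ^ 2 * m.ρ t - m.g * m.k ^ 2 * m.r t + lam * m.μ * m.k ^ 4)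
          * ((t - x) ^ 3 / 6) + lam * m.μ * m.k ^ 2 * (t - x)) * p.f t)
        + (∫ t in x..0, ((lam ^ 2 * m.ρ t + 3 * lam * m.μ * m.k ^ 2) * ((t - x) ^ 2 / 2)) * p.f1 t)
        + ∫ t in x..0, (lam * m.μ * p.f2 t * ((t - x) + m.k ^ 2 * ((t - x) ^ 3 / 6))
          + lam * m.μ * m.k ^ 2 * p.f1 t * ((t - x) ^ 2 / 2)) := by
    rw [← intervalIntegral.integral_add (Continuous.intervalIntegrable (by fun_prop) _ _)
      (Continuous.intervalIntegrable (by fun_prop) _ _),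
      ← intervalIntegral.integral_add (Continuous.intervalIntegrable (by fun_prop) _ _)
      (Continuous.intervalIntegrable (by fun_prop) _ _)]
    refine intervalIntegral.integral_congr fun t ht => ?_
    rw [uIcc_of_le hx] at ht
    simp only [Profile.cubic]
    rw [max_eq_left (sub_nonneg.2 ht.1)]
    ring
  rw [e2, e1]
  simp only [Profile.cubic]
  rw [max_eq_left (by linarith)]
  ring

lemma weak_eq_zero {lam : ℝ} (hpos : ∀ p, 0 ≤ m.form lam p p) {p : ℕ → Profile}
    (hQ : Tendsto (fun n => m.form lam (p n) (p n)) atTop (nhds 0)) {R : ℝ}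
    (hR : ∀ n, (p n).normSq ≤ R) {F F1 : ℝ → ℝ}
    (hF : ∀ x ≤ 0, Tendsto (fun n => (p n).f x) atTop (nhds (F x)))
    (hF1 : ∀ x ≤ 0, Tendsto (fun n => (p n).f1 x) atTop (nhds (F1 x))) {x : ℝ} (hx : x ≤ 0) :
    m.weak lam x F F1 = 0 := by
  have hρ := m.ρ_cont
  have hr := m.r_cont
  have h := m.tendsto_form_zero hpos hQ (Profile.cubic x)
  simp only [fun n => m.form_cubic lam (p n) hx] at h
  refine tendsto_nhds_unique ?_ h
  unfold weak
  refine (((tendsto_integral_mul_of_bounded (by fun_prop) (fun n => (p n).c0)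
    (fun n y hy => Real.abs_le_sqrt (((p n).f_sq_le hy).trans (hR n))) hF hx).add
    (tendsto_integral_mul_of_bounded (by fun_prop) (fun n => (p n).c1)
    (fun n y hy => Real.abs_le_sqrt (((p n).f1_sq_le hy).trans (hR n))) hF1 hx)).add ?_).add ?_
  · exact ((((hF1 0 le_rfl).mul_const _).sub (hF 0 le_rfl)).add (hF x hx)).const_mul _
  · exact (((hF1 0 le_rfl).const_mul _).add ((hF 0 le_rfl).const_mul _)).mul_const _

end Medium

/-- The primitive of `G` vanishing at the origin. -/
def prim (G : ℝ → ℝ) (x : ℝ) : ℝ := ∫ t in (0:ℝ)..x, G t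

lemma prim_zero (G : ℝ → ℝ) : prim G 0 = 0 := intervalIntegral.integral_same

lemma hasDerivAt_prim {G : ℝ → ℝ} (hG : Continuous G) (x : ℝ) : HasDerivAt (prim G) (G x) x :=
  intervalIntegral.integral_hasDerivAt_right (hG.intervalIntegrable _ _)
    hG.aestronglyMeasurable.stronglyMeasurableAtFilter hG.continuousAt

lemma continuous_prim {G : ℝ → ℝ} (hG : Continuous G) : Continuous (prim G) :=
  continuous_iff_continuousAt.2 fun x => (hasDerivAt_prim hG x).continuousAt

lemma integral_mul_sub {G : ℝ → ℝ} (hG : Continuous G) (x : ℝ) :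
    ∫ t in x..0, (t - x) * G t = prim (prim G) x := by
  have h1 := continuous_prim hG
  have h := intervalIntegral.integral_eq_sub_of_hasDerivAt (a := x) (b := 0)
    (f := fun t => (t - x) * prim G t - prim (prim G) t) (f' := fun t => (t - x) * G t)
    (fun t _ => by
      refine ((((hasDerivAt_id t).sub_const x).mul (hasDerivAt_prim hG t)).sub
        (hasDerivAt_prim h1 t)).congr_deriv ?_
      simp)
    (by apply Continuous.intervalIntegrable; fun_prop)
  rw [h]
  simp [prim_zero]

lemma integral_mul_sub_sq {G : ℝ → ℝ} (hG : Continuous G) (x : ℝ) :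
    ∫ t in x..0, (t - x) ^ 2 / 2 * G t = -prim (prim (prim G)) x := by
  have h1 := continuous_prim hG
  have h2 := continuous_prim h1
  have h := intervalIntegral.integral_eq_sub_of_hasDerivAt (a := x) (b := 0)
    (f := fun t => (t - x) ^ 2 / 2 * prim G t - (t - x) * prim (prim G) t
      + prim (prim (prim G)) t) (f' := fun t => (t - x) ^ 2 / 2 * G t)
    (fun t _ => by
      have hs : HasDerivAt (fun t => t - x) 1 t := (hasDerivAt_id t).sub_const x
      refine (((((hs.fun_pow 2).div_const 2).mul (hasDerivAt_prim hG t)).sub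
        (hs.mul (hasDerivAt_prim h1 t))).add (hasDerivAt_prim h2 t)).congr_deriv ?_
      simp
      ring)
    (by apply Continuous.intervalIntegrable; fun_prop)
  rw [h]
  simp [prim_zero]

lemma integral_mul_sub_cube {G : ℝ → ℝ} (hG : Continuous G) (x : ℝ) :
    ∫ t in x..0, (t - x) ^ 3 / 6 * G t = prim (prim (prim (prim G))) x := by
  have h1 := continuous_prim hG
  have h2 := continuous_prim h1
  have h3 := continuous_prim h2
  have h := intervalIntegral.integral_eq_sub_of_hasDerivAt (a := x) (b := 0)
    (f := fun t => (t - x) ^ 3 / 6 * prim G t - (t - x) ^ 2 / 2 * prim (prim G) t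
      + (t - x) * prim (prim (prim G)) t - prim (prim (prim (prim G))) t)
    (f' := fun t => (t - x) ^ 3 / 6 * G t)
    (fun t _ => by
      have hs : HasDerivAt (fun t => t - x) 1 t := (hasDerivAt_id t).sub_const x
      refine ((((((hs.fun_pow 3).div_const 6).mul (hasDerivAt_prim hG t)).sub
        (((hs.fun_pow 2).div_const 2).mul (hasDerivAt_prim h1 t))).add
        (hs.mul (hasDerivAt_prim h2 t))).sub (hasDerivAt_prim h3 t)).congr_deriv ?_
      simp
      ring)
    (by apply Continuous.intervalIntegrable; fun_prop)
  rw [h]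
  simp [prim_zero]

namespace Medium

variable (m : Medium)

/-- A `C¹` solution of the integrated equation is `C⁴` and solves the boundary value problem. -/
lemma exists_derivatives {lam : ℝ} (hlam : 0 < lam) {F F1 : ℝ → ℝ} (hF : Continuous F)
    (hF1 : Continuous F1) (hd : ∀ x < 0, HasDerivAt F (F1 x) x)
    (hw : ∀ x ≤ 0, m.weak lam x F F1 = 0) :
    ∃ h2 h3 h4 : ℝ → ℝ, Continuous h2 ∧ Continuous h3 ∧ Continuous h4 ∧
      (∀ x < 0, HasDerivAt F1 (h2 x) x) ∧ (∀ x < 0, HasDerivAt h2 (h3 x) x) ∧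
      (∀ x < 0, HasDerivAt h3 (h4 x) x) ∧
      h2 0 = -m.k ^ 2 * F 0 ∧
      lam * m.μ * h3 0 = (lam ^ 2 * m.ρp + 3 * lam * m.μ * m.k ^ 2) * F1 0
        + m.g * m.k ^ 2 * m.ρp * F 0 ∧
      ∀ x, h4 x = (-((lam ^ 2 * m.k ^ 2 * m.ρ x - m.g * m.k ^ 2 * m.r x
        + lam * m.μ * m.k ^ 4) * F x) + lam ^ 2 * m.r x * F1 x
        + (lam ^ 2 * m.ρ x + 2 * lam * m.μ * m.k ^ 2) * h2 x) / (lam * m.μ) := by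
  have hρ := m.ρ_cont
  have hr := m.r_cont
  have hμ := m.μ_pos.ne'
  have hν : lam * m.μ ≠ 0 := (mul_pos hlam m.μ_pos).ne'
  set U : ℝ → ℝ := fun x => (lam ^ 2 * m.k ^ 2 * m.ρ x - m.g * m.k ^ 2 * m.r x
    + lam * m.μ * m.k ^ 4) * F x with hU
  set Z : ℝ → ℝ := fun x => (lam ^ 2 * m.ρ x + 3 * lam * m.μ * m.k ^ 2) * F1 x with hZ
  set c := lam * m.μ * m.k ^ 2 * F1 0 + m.g * m.k ^ 2 * m.ρp * F 0 with hc
  have cU : Continuous U := by fun_prop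
  have cZ : Continuous Z := by fun_prop
  have cU1 := continuous_prim cU
  have cU2 := continuous_prim cU1
  have cU3 := continuous_prim cU2
  have cZ1 := continuous_prim cZ
  have cZ2 := continuous_prim cZ1
  have cX1 := continuous_prim hF
  have e0 : ∀ x ≤ 0, F x = F 0 + F1 0 * x + (c * x ^ 3 / 6 - prim (prim (prim (prim U))) x
      + prim (prim (prim Z)) x - lam * m.μ * m.k ^ 2 * prim (prim F) x) / (lam * m.μ) := by
    intro x hx
    have h := hw x hx
    unfold weak at h
    have i1 : (∫ t in x..0, ((lam ^ 2 * m.k ^ 2 * m.ρ t - m.g * m.k ^ 2 * m.r t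
        + lam * m.μ * m.k ^ 4) * ((t - x) ^ 3 / 6) + lam * m.μ * m.k ^ 2 * (t - x)) * F t)
        = prim (prim (prim (prim U))) x + lam * m.μ * m.k ^ 2 * prim (prim F) x := by
      rw [← integral_mul_sub_cube cU, ← integral_mul_sub hF,
        ← intervalIntegral.integral_const_mul, ← intervalIntegral.integral_add]
      · refine intervalIntegral.integral_congr fun t _ => ?_
        simp only [hU]
        ring
      · apply Continuous.intervalIntegrable; fun_prop
      · apply Continuous.intervalIntegrable; fun_prop
    have i2 : (∫ t in x..0, ((lam ^ 2 * m.ρ t + 3 * lam * m.μ * m.k ^ 2)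
        * ((t - x) ^ 2 / 2)) * F1 t) = -prim (prim (prim Z)) x := by
      rw [← integral_mul_sub_sq cZ]
      refine intervalIntegral.integral_congr fun t _ => ?_
      simp only [hZ]
      ring
    rw [i1, i2] at h
    field_simp
    linear_combination 6 * h
  have e1 : ∀ x < 0, F1 x = F1 0 + (c * x ^ 2 / 2 - prim (prim (prim U)) x
      + prim (prim Z) x - lam * m.μ * m.k ^ 2 * prim F x) / (lam * m.μ) := by
    intro x hx
    refine (hd x hx).unique (HasDerivAt.congr_of_eventuallyEq ?_
      ((eventually_lt_nhds hx).mono fun y hy => e0 y (le_of_lt hy)))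
    refine ((((hasDerivAt_id x).const_mul (F1 0)).const_add (F 0)).add
      (((((((hasDerivAt_id x).fun_pow 3).const_mul c).div_const 6).sub (hasDerivAt_prim cU3 x)).add
      (hasDerivAt_prim cZ2 x)).sub ((hasDerivAt_prim cX1 x).const_mul _)
      |>.div_const (lam * m.μ))).congr_deriv ?_
    simp
    ring
  refine ⟨fun x => (c * x - prim (prim U) x + prim Z x - lam * m.μ * m.k ^ 2 * F x) / (lam * m.μ),
    fun x => (c - prim U x + Z x - lam * m.μ * m.k ^ 2 * F1 x) / (lam * m.μ),
    fun x => (-U x + lam ^ 2 * m.r x * F1 x + (lam ^ 2 * m.ρ x + 2 * lam * m.μ * m.k ^ 2)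
      * ((c * x - prim (prim U) x + prim Z x - lam * m.μ * m.k ^ 2 * F x) / (lam * m.μ)))
      / (lam * m.μ), by fun_prop, by fun_prop, by fun_prop, fun x hx => ?_, fun x hx => ?_,
    fun x hx => ?_, ?_, ?_, fun x => rfl⟩
  · refine HasDerivAt.congr_of_eventuallyEq ?_ ((eventually_lt_nhds hx).mono fun y hy => e1 y hy)
    refine ((((((((hasDerivAt_id x).fun_pow 2).const_mul c).div_const 2).sub
      (hasDerivAt_prim cU2 x)).add
      (hasDerivAt_prim cZ1 x)).sub ((hasDerivAt_prim hF x).const_mul _)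
      |>.div_const (lam * m.μ)).const_add _).congr_deriv ?_
    simp
    ring
  · refine (((((hasDerivAt_id x).const_mul c).sub (hasDerivAt_prim cU1 x)).add
      (hasDerivAt_prim cZ x)).sub ((hd x hx).const_mul _) |>.div_const (lam * m.μ)).congr_deriv ?_
    simp
  · have d2 : HasDerivAt F1 ((c * x - prim (prim U) x + prim Z x - lam * m.μ * m.k ^ 2 * F x)
        / (lam * m.μ)) x := by
      refine HasDerivAt.congr_of_eventuallyEq ?_
        ((eventually_lt_nhds hx).mono fun y hy => e1 y hy)
      refine ((((((((hasDerivAt_id x).fun_pow 2).const_mul c).div_const 2).sub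
        (hasDerivAt_prim cU2 x)).add
        (hasDerivAt_prim cZ1 x)).sub ((hasDerivAt_prim hF x).const_mul _)
        |>.div_const (lam * m.μ)).const_add _).congr_deriv ?_
      simp
      ring
    have dZ := (((m.hasDeriv x).const_mul (lam ^ 2)).add_const (3 * lam * m.μ * m.k ^ 2)).mul d2
    refine ((((hasDerivAt_prim cU x).const_sub c).add dZ).sub
      (d2.const_mul (lam * m.μ * m.k ^ 2)) |>.div_const (lam * m.μ)).congr_deriv ?_
    ring
  · simp only [prim_zero]
    field_simp
    ring
  · simp only [prim_zero, hZ, hc, m.ρ_zero]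
    field_simp
    ring

end Medium

lemma integrableOn_mul_sq {w f : ℝ → ℝ} {s : Set ℝ} {K : ℝ} (hw : Continuous w)
    (hK : ∀ x, |w x| ≤ K) (hf : IntegrableOn (fun x => f x ^ 2) s) :
    IntegrableOn (fun x => (w x * f x) ^ 2) s := by
  simp only [mul_pow]
  refine integrableOn_bdd_mul (K := K ^ 2) (hw.pow 2) (fun x => ?_) hf
  rw [abs_pow]
  exact pow_le_pow_left₀ (abs_nonneg _) (hK x) 2

lemma integrableOn_sq_of_forall_le {f : ℝ → ℝ} (hf : Continuous f) {R : ℝ}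
    (hR : ∀ y ≤ 0, ∫ t in y..0, f t ^ 2 ≤ R) : IntegrableOn (fun x => f x ^ 2) (Iio 0) := by
  refine IntegrableOn.mono_set (integrableOn_Iic_of_intervalIntegral_norm_bounded (l := atBot)
    (a := id) R 0 (fun i => ?_) tendsto_id ?_) Iio_subset_Iic_self
  · exact ((hf.pow 2).integrableOn_Icc).mono_set Ioc_subset_Icc_self
  · filter_upwards [eventually_le_atBot 0] with y hy
    simpa only [norm_pow, Real.norm_eq_abs, sq_abs, id] using hR y hy

lemma intervalIntegral_le_setIntegral_Iio {f : ℝ → ℝ} (hf : IntegrableOn f (Iio 0))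
    (h0 : ∀ x, 0 ≤ f x) {y : ℝ} (hy : y ≤ 0) : ∫ t in y..0, f t ≤ ∫ t in Iio 0, f t := by
  rw [intervalIntegral.integral_of_le hy, integral_Ioc_eq_integral_Ioo]
  exact setIntegral_mono_set hf (ae_of_all _ h0) (Ioo_subset_Iio_self).eventuallyLE

lemma tendsto_intervalIntegral_of_bounded {f : ℕ → ℝ → ℝ} {F : ℝ → ℝ} {K y : ℝ}
    (hc : ∀ n, Continuous (f n)) (hK : ∀ n, ∀ x ≤ 0, y ≤ x → |f n x| ≤ K)
    (hF : ∀ x ≤ 0, Tendsto (fun n => f n x) atTop (nhds (F x))) (hy : y ≤ 0) :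
    Tendsto (fun n => ∫ t in y..0, f n t) atTop (nhds (∫ t in y..0, F t)) := by
  refine intervalIntegral.tendsto_integral_filter_of_dominated_convergence (fun _ => K)
    (Eventually.of_forall fun n => (hc n).aestronglyMeasurable)
    (Eventually.of_forall fun n => ae_of_all _ fun t ht => ?_) intervalIntegrable_const
    (ae_of_all _ fun t ht => ?_)
  · rw [uIoc_of_le hy] at ht
    exact hK n t ht.2 ht.1.le
  · rw [uIoc_of_le hy] at ht
    exact hF t ht.2

lemma integrableOn_sq_of_tendsto {f : ℕ → ℝ → ℝ} {F : ℝ → ℝ} {K R : ℝ} (hFc : Continuous F)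
    (hc : ∀ n, Continuous (f n)) (hK : ∀ n, ∀ x ≤ 0, f n x ^ 2 ≤ K)
    (hi : ∀ n, IntegrableOn (fun x => f n x ^ 2) (Iio 0))
    (hR : ∀ n, ∫ x in Iio 0, f n x ^ 2 ≤ R)
    (hF : ∀ x ≤ 0, Tendsto (fun n => f n x) atTop (nhds (F x))) :
    IntegrableOn (fun x => F x ^ 2) (Iio 0) := by
  refine integrableOn_sq_of_forall_le (R := R) hFc fun y hy => ?_
  refine le_of_tendsto (tendsto_intervalIntegral_of_bounded (K := K) (fun n => (hc n).pow 2)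
    (fun n x hx _ => ?_) (fun x hx => (hF x hx).pow 2) hy) (Eventually.of_forall fun n => ?_)
  · rw [abs_of_nonneg (sq_nonneg _)]
    exact hK n x hx
  · exact (intervalIntegral_le_setIntegral_Iio (hi n) (fun x => sq_nonneg _) hy).trans (hR n)

/-- A weak limit of second derivatives is square integrable. -/
lemma integrableOn_sq_of_profile {p : ℕ → Profile} {R : ℝ} (hR : ∀ n, (p n).normSq ≤ R)
    {F1 h2 h3 : ℝ → ℝ} (hF1 : Continuous F1) (c2 : Continuous h2) (c3 : Continuous h3)
    (d1 : ∀ x < 0, HasDerivAt F1 (h2 x) x) (d2 : ∀ x < 0, HasDerivAt h2 (h3 x) x)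
    (hF : ∀ x ≤ 0, Tendsto (fun n => (p n).f1 x) atTop (nhds (F1 x))) :
    IntegrableOn (fun x => h2 x ^ 2) (Iio 0) := by
  refine integrableOn_sq_of_forall_le (R := R) c2 fun y hy => ?_
  have parts : ∀ f f1 : ℝ → ℝ, Continuous f → Continuous f1 → (∀ x < 0, HasDerivAt f (f1 x) x) →
      ∫ t in y..0, f1 t * h2 t = f 0 * h2 0 - f y * h2 y - ∫ t in y..0, f t * h3 t := by
    intro f f1 cf cf1 hd
    have h := integral_eq_sub_of_neg (cf.mul c2) ((cf1.mul c2).add (cf.mul c3))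
      (fun x hx => (hd x hx).mul (d2 x hx)) hy le_rfl
    rw [← Pi.mul_apply, ← Pi.mul_apply f, ← h, ← intervalIntegral.integral_sub]
    · simp
    · apply Continuous.intervalIntegrable; fun_prop
    · apply Continuous.intervalIntegrable; fun_prop
  obtain ⟨K, hK⟩ := isCompact_Icc.exists_bound_of_continuousOn (s := Icc y 0) c3.continuousOn
  have hK0 : 0 ≤ K := (norm_nonneg _).trans (hK 0 ⟨hy, le_rfl⟩)
  have lim : Tendsto (fun n => ∫ t in y..0, (p n).f2 t * h2 t) atTop
      (nhds (∫ t in y..0, h2 t * h2 t)) := by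
    simp only [fun n => parts (p n).f1 (p n).f2 (p n).c1 (p n).c2 (p n).d1]
    rw [parts F1 h2 hF1 c2 d1]
    refine (((hF 0 le_rfl).mul_const _).sub ((hF y hy).mul_const _)).sub
      (tendsto_intervalIntegral_of_bounded (K := √R * K) (fun n => (p n).c1.mul c3)
      (fun n x hx hyx => ?_) (fun x hx => (hF x hx).mul_const _) hy)
    rw [abs_mul]
    exact mul_le_mul (Real.abs_le_sqrt (((p n).f1_sq_le hx).trans (hR n))) (hK x ⟨hyx, hx⟩)
      (abs_nonneg _) (Real.sqrt_nonneg _)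
  have hle : ∫ t in y..0, h2 t * h2 t ≤ (R + ∫ t in y..0, h2 t ^ 2) / 2 := by
    refine le_of_tendsto lim (Eventually.of_forall fun n => ?_)
    have cp := (p n).c2
    have e1 : ∫ t in y..0, (p n).f2 t ^ 2 ≤ R := by
      refine (intervalIntegral_le_setIntegral_Iio (p n).i2 (fun x => sq_nonneg _) hy).trans
        (le_trans ?_ (hR n))
      have a0 : 0 ≤ ∫ x in Iio 0, (p n).f x ^ 2 := integral_nonneg fun x => by positivity
      have a1 : 0 ≤ ∫ x in Iio 0, (p n).f1 x ^ 2 := integral_nonneg fun x => by positivity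
      unfold Profile.normSq
      linarith
    have e2 : ∫ t in y..0, (p n).f2 t * h2 t
        ≤ ∫ t in y..0, ((p n).f2 t ^ 2 + h2 t ^ 2) / 2 := by
      refine intervalIntegral.integral_mono_on hy ?_ ?_ fun t _ => ?_
      · apply Continuous.intervalIntegrable; fun_prop
      · apply Continuous.intervalIntegrable; fun_prop
      · nlinarith [sq_nonneg ((p n).f2 t - h2 t)]
    rw [intervalIntegral.integral_div, intervalIntegral.integral_add] at e2
    · linarith
    · apply Continuous.intervalIntegrable; fun_prop
    · apply Continuous.intervalIntegrable; fun_prop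
  simp only [← sq] at hle
  linarith

/-- Interpolation on the half line: if a function and its second derivative are square integrable,
so is its first derivative. -/
lemma integrableOn_deriv_sq {f f1 f2 : ℝ → ℝ} (c0 : Continuous f) (c1 : Continuous f1)
    (c2 : Continuous f2) (d0 : ∀ x < 0, HasDerivAt f (f1 x) x)
    (d1 : ∀ x < 0, HasDerivAt f1 (f2 x) x) (i0 : IntegrableOn (fun x => f x ^ 2) (Iio 0))
    (i2 : IntegrableOn (fun x => f2 x ^ 2) (Iio 0)) :
    IntegrableOn (fun x => f1 x ^ 2) (Iio 0) := by
  have im := integrableOn_mul_of_sq c0 c2 i0 i2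
  refine integrableOn_sq_of_forall_le
    (R := f 0 * f1 0 + 1 + ∫ x in Iio 0, |f x * f2 x|) c1 fun y hy => ?_
  obtain ⟨z, hz, hz1⟩ : ∃ z ≤ y, -1 ≤ f z * f1 z := by
    by_contra! hcon
    have hgrow : ∀ z ≤ y, f y ^ 2 + 2 * (y - z) ≤ f z ^ 2 := by
      intro z hz
      have h := integral_eq_sub_of_neg (f1 := fun x => 2 * (f x * f1 x)) (c0.pow 2)
        (by fun_prop) (fun x hx => by
          refine ((d0 x hx).fun_pow 2).congr_deriv ?_
          simp only [Nat.cast_ofNat, Nat.add_one_sub_one, pow_one]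
          ring) hz hy
      have h2 : ∫ t in z..y, 2 * (f t * f1 t) ≤ ∫ t in z..y, (-2 : ℝ) := by
        refine intervalIntegral.integral_mono_on hz ?_ intervalIntegrable_const fun t ht => ?_
        · apply Continuous.intervalIntegrable; fun_prop
        · linarith [hcon t ht.2]
      rw [h] at h2
      simp at h2
      linarith
    have h1 : IntegrableOn (fun _ => (1:ℝ)) (Iic (y - 1)) := by
      refine Integrable.mono' (i0.mono_set (Iic_subset_Iio.2 (by linarith)))
        aestronglyMeasurable_const ((ae_restrict_iff' measurableSet_Iic).2
        (ae_of_all _ fun x hx => ?_))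
      have hx' : x ≤ y - 1 := hx
      have := hgrow x (by linarith)
      simp only [norm_one]
      nlinarith [sq_nonneg (f y)]
    rw [integrableOn_const_iff] at h1
    simp at h1
  have hz0 : z ≤ 0 := hz.trans hy
  have h := integral_eq_sub_of_neg (f := fun x => f x * f1 x)
    (f1 := fun x => f1 x ^ 2 + f x * f2 x) (by fun_prop) (by fun_prop)
    (fun x hx => ((d0 x hx).mul (d1 x hx)).congr_deriv (by ring)) hz0 le_rfl
  rw [intervalIntegral.integral_add] at h
  rotate_left
  · apply Continuous.intervalIntegrable; fun_prop
  · apply Continuous.intervalIntegrable; fun_prop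
  have e1 : -∫ t in z..0, f t * f2 t ≤ ∫ x in Iio 0, |f x * f2 x| := by
    refine le_trans ?_ (intervalIntegral_le_setIntegral_Iio im.abs (fun x => abs_nonneg _) hz0)
    refine (neg_le_abs _).trans ?_
    exact intervalIntegral.abs_integral_le_integral_abs hz0
  have e2 : ∫ t in y..0, f1 t ^ 2 ≤ ∫ t in z..0, f1 t ^ 2 := by
    refine intervalIntegral.integral_mono_interval hz hy le_rfl
      (ae_of_all _ fun t => sq_nonneg _) ?_
    apply Continuous.intervalIntegrable; fun_prop
  linarith

lemma add_prim_eq {f f1 G : ℝ → ℝ} (cf : Continuous f) (cf1 : Continuous f1)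
    (hd : ∀ x < 0, HasDerivAt f (f1 x) x) (hG : ∀ x ≤ 0, G x = f1 x) {x : ℝ} (hx : x ≤ 0) :
    f 0 + prim G x = f x := by
  have h := integral_eq_sub_of_neg cf cf1 hd hx le_rfl
  have : prim G x = -∫ t in x..0, f1 t := by
    rw [prim, intervalIntegral.integral_symm]
    congr 1
    refine intervalIntegral.integral_congr fun t ht => hG t ?_
    rw [uIcc_of_le hx] at ht
    exact ht.2
  rw [this, h]
  ring

lemma exists_contDiff_extension {F F1 h2 h3 h4 : ℝ → ℝ} (cF : Continuous F) (cF1 : Continuous F1)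
    (c2 : Continuous h2) (c3 : Continuous h3) (c4 : Continuous h4)
    (d0 : ∀ x < 0, HasDerivAt F (F1 x) x) (d1 : ∀ x < 0, HasDerivAt F1 (h2 x) x)
    (d2 : ∀ x < 0, HasDerivAt h2 (h3 x) x) (d3 : ∀ x < 0, HasDerivAt h3 (h4 x) x) :
    ∃ φ : ℝ → ℝ, ContDiff ℝ 4 φ ∧ ∀ x ≤ 0, φ x = F x ∧ deriv φ x = F1 x ∧
      iteratedDeriv 2 φ x = h2 x ∧ iteratedDeriv 3 φ x = h3 x ∧ iteratedDeriv 4 φ x = h4 x := by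
  set f3 : ℝ → ℝ := fun x => h3 0 + prim h4 x with hf3
  have D3 : ∀ x, HasDerivAt f3 (h4 x) x := fun x => (hasDerivAt_prim c4 x).const_add _
  have C3 : Continuous f3 := continuous_iff_continuousAt.2 fun x => (D3 x).continuousAt
  set f2 : ℝ → ℝ := fun x => h2 0 + prim f3 x with hf2
  have D2 : ∀ x, HasDerivAt f2 (f3 x) x := fun x => (hasDerivAt_prim C3 x).const_add _
  have C2 : Continuous f2 := continuous_iff_continuousAt.2 fun x => (D2 x).continuousAt
  set f1 : ℝ → ℝ := fun x => F1 0 + prim f2 x with hf1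
  have D1 : ∀ x, HasDerivAt f1 (f2 x) x := fun x => (hasDerivAt_prim C2 x).const_add _
  have C1 : Continuous f1 := continuous_iff_continuousAt.2 fun x => (D1 x).continuousAt
  set f : ℝ → ℝ := fun x => F 0 + prim f1 x with hf
  have D0 : ∀ x, HasDerivAt f (f1 x) x := fun x => (hasDerivAt_prim C1 x).const_add _
  have e0 : deriv f = f1 := funext fun x => (D0 x).deriv
  have e1 : deriv f1 = f2 := funext fun x => (D1 x).deriv
  have e2 : deriv f2 = f3 := funext fun x => (D2 x).deriv
  have e3 : deriv f3 = h4 := funext fun x => (D3 x).deriv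
  have E3 : ∀ x ≤ 0, f3 x = h3 x := fun x hx => add_prim_eq c3 c4 d3 (fun _ _ => rfl) hx
  have E2 : ∀ x ≤ 0, f2 x = h2 x := fun x hx => add_prim_eq c2 c3 d2 E3 hx
  have E1 : ∀ x ≤ 0, f1 x = F1 x := fun x hx => add_prim_eq cF1 c2 d1 E2 hx
  have E0 : ∀ x ≤ 0, f x = F x := fun x hx => add_prim_eq cF cF1 d0 E1 hx
  have step : ∀ (n : ℕ) (u v : ℝ → ℝ), (∀ x, HasDerivAt u (v x) x) → ContDiff ℝ n v →
      ContDiff ℝ (n + 1 : ℕ) u := by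
    intro n u v hd hv
    have : deriv u = v := funext fun x => (hd x).deriv
    push_cast
    refine contDiff_succ_iff_deriv.2 ⟨fun x => (hd x).differentiableAt, by simp, ?_⟩
    rwa [this]
  refine ⟨f, ?_, fun x hx => ?_⟩
  · exact step 3 f f1 D0 (step 2 f1 f2 D1 (step 1 f2 f3 D2 (step 0 f3 h4 D3 (by
      simpa using contDiff_zero (𝕜 := ℝ).2 c4))))
  · simp only [iteratedDeriv_succ', iteratedDeriv_zero, e0, e1, e2, e3]
    exact ⟨E0 x hx, E1 x hx, E2 x hx, E3 x hx, trivial⟩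

namespace Medium

variable (m : Medium)

/-- If every characteristic value is at most `Λ`, the energy form with parameter `Λ` is
nonnegative. -/
theorem form_nonneg {Λ : ℝ} (hΛ : 0 < Λ)
    (h : ∀ lam, IsCharValue m.μ m.g m.k m.ρp m.ρ lam → lam ≤ Λ) (p : Profile) :
    0 ≤ m.form Λ p p := by
  by_contra! hneg
  obtain ⟨lam, hlt, hpos, q, hC, hQ⟩ := m.exists_critical hΛ p hneg
  have hlam : 0 < lam := hΛ.trans hlt
  refine absurd (h lam ?_) (not_le.2 hlt)
  obtain ⟨R, hR⟩ := m.normSq_bounded hlam q hC hQ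
  obtain ⟨s, hs, F, F1, cF, cF1, d0, hF, hF1, x₀, hx₀, hne⟩ := m.exists_limit hlam hpos q hC hQ
  have hR' : ∀ n, (q (s n)).normSq ≤ R := fun n => hR (s n)
  have hw : ∀ x ≤ 0, m.weak lam x F F1 = 0 := fun x hx =>
    m.weak_eq_zero hpos (hQ.comp hs.tendsto_atTop) hR' hF hF1 hx
  obtain ⟨h2, h3, h4, c2, c3, c4, d1, d2, d3, b2, b3, e4⟩ :=
    m.exists_derivatives hlam cF cF1 d0 hw
  have n0 : ∀ p : Profile, 0 ≤ ∫ x in Iio 0, p.f x ^ 2 :=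
    fun p => integral_nonneg fun x => by positivity
  have n1 : ∀ p : Profile, 0 ≤ ∫ x in Iio 0, p.f1 x ^ 2 :=
    fun p => integral_nonneg fun x => by positivity
  have n2 : ∀ p : Profile, 0 ≤ ∫ x in Iio 0, p.f2 x ^ 2 :=
    fun p => integral_nonneg fun x => by positivity
  have i0 : IntegrableOn (fun x => F x ^ 2) (Iio 0) :=
    integrableOn_sq_of_tendsto (K := R) (R := R) cF (fun n => (q (s n)).c0)
      (fun n x hx => ((q (s n)).f_sq_le hx).trans (hR' n)) (fun n => (q (s n)).i0)
      (fun n => by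
        have := hR' n
        unfold Profile.normSq at this
        linarith [n1 (q (s n)), n2 (q (s n))]) hF
  have i1 : IntegrableOn (fun x => F1 x ^ 2) (Iio 0) :=
    integrableOn_sq_of_tendsto (K := R) (R := R) cF1 (fun n => (q (s n)).c1)
      (fun n x hx => ((q (s n)).f1_sq_le hx).trans (hR' n)) (fun n => (q (s n)).i1)
      (fun n => by
        have := hR' n
        unfold Profile.normSq at this
        linarith [n0 (q (s n)), n2 (q (s n))]) hF1
  have i2 := integrableOn_sq_of_profile hR' cF1 c2 c3 d1 d2 hF1
  have i4 : IntegrableOn (fun x => h4 x ^ 2) (Iio 0) := by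
    have hρ := m.ρ_cont
    have hrc := m.r_cont
    set ν := lam * m.μ with hν
    have bd : ∀ (u v w : ℝ) (x : ℝ), |u * m.ρ x + v * m.r x + w| ≤ |u| * m.ρp + |v| * m.M + |w| :=
      fun u v w x => (abs_add_three _ _ _).trans (by
        rw [abs_mul, abs_mul]
        gcongr
        · exact m.abs_ρ_le x
        · exact m.abs_r_le x)
    have j0 := integrableOn_mul_sq (w := fun x => -(lam ^ 2 * m.k ^ 2 / ν) * m.ρ x
      + m.g * m.k ^ 2 / ν * m.r x + -(m.k ^ 4)) (by fun_prop) (bd _ _ _) i0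
    have j1 := integrableOn_mul_sq (w := fun x => 0 * m.ρ x + lam ^ 2 / ν * m.r x + 0)
      (by fun_prop) (bd _ _ _) i1
    have j2 := integrableOn_mul_sq (w := fun x => lam ^ 2 / ν * m.ρ x + 0 * m.r x + 2 * m.k ^ 2)
      (by fun_prop) (bd _ _ _) i2
    have j := integrableOn_sq_add (by fun_prop) (by fun_prop)
      (integrableOn_sq_add (by fun_prop) (by fun_prop) j0 j1 1) j2 1
    refine j.congr_fun (fun x _ => ?_) measurableSet_Iio
    have hμ := m.μ_pos.ne'
    simp only [e4, hν]
    congr 1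
    field_simp
    ring
  have i3 := integrableOn_deriv_sq c2 c3 c4 d2 d3 i2 i4
  obtain ⟨φ, hφ, E⟩ := exists_contDiff_extension cF cF1 c2 c3 c4 d0 d1 d2 d3
  have hr : deriv m.ρ = m.r := funext fun x => (m.hasDeriv x).deriv
  obtain ⟨z0, z1, z2, z3, -⟩ := E 0 le_rfl
  have hμ := m.μ_pos.ne'
  refine ⟨hlam, φ, hφ, fun n hn => ?_, fun x hx => ?_, ?_, ?_, ?_, x₀, hx₀, ?_⟩
  · have cg : ∀ u v : ℝ → ℝ, (∀ x ≤ 0, u x = v x) → IntegrableOn (fun x => v x ^ 2) (Iio 0) →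
        IntegrableOn (fun x => u x ^ 2) (Iio 0) := fun u v huv hv =>
      hv.congr_fun (fun x hx => by simp only [huv x (le_of_lt hx)]) measurableSet_Iio
    interval_cases n
    · simp only [iteratedDeriv_zero]
      exact cg _ _ (fun x hx => (E x hx).1) i0
    · simp only [iteratedDeriv_one]
      exact cg _ _ (fun x hx => (E x hx).2.1) i1
    · exact cg _ _ (fun x hx => (E x hx).2.2.1) i2
    · exact cg _ _ (fun x hx => (E x hx).2.2.2.1) i3
    · exact cg _ _ (fun x hx => (E x hx).2.2.2.2) i4
  · obtain ⟨x0, x1, x2, x3, x4⟩ := E x hx.le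
    have hev : (fun y => m.ρ y * deriv φ y) =ᶠ[nhds x] fun y => m.ρ y * F1 y :=
      (eventually_lt_nhds hx).mono fun y hy => by simp only [(E y (le_of_lt hy)).2.1]
    rw [hev.deriv_eq, ((m.hasDeriv x).fun_mul (d1 x hx)).deriv, x0, x2, x4, e4, hr]
    field_simp
    ring
  · rw [z0, z2, b2]
    ring
  · rw [z0, z1, z3]
    linear_combination -b3
  · have ht := (Profile.sq_le_of_hasDerivAt cF cF1 d0 i0 i1).1
    have ht2 : Tendsto F atBot (nhds 0) := by
      rw [tendsto_zero_iff_abs_tendsto_zero]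
      simpa [Function.comp_def, Real.sqrt_sq_eq_abs] using ht.sqrt
    exact ht2.congr' ((eventually_le_atBot 0).mono fun x hx => ((E x hx).1).symm)
  · rwa [(E x₀ hx₀).1]

end Medium

/-- The conjugate plane wave with wave number `κ`. -/
def wave (κ t : ℝ) : ℂ := Complex.exp (-(κ * t * Complex.I))

lemma hasDerivAt_wave (κ t : ℝ) : HasDerivAt (wave κ) (-(κ * Complex.I) * wave κ t) t := by
  have h : HasDerivAt (fun t : ℝ => -((κ:ℂ) * t * Complex.I)) (-(κ * Complex.I)) t := by
    simpa using (((hasDerivAt_id t).ofReal_comp.const_mul (κ:ℂ)).mul_const Complex.I).fun_neg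
  exact h.cexp.congr_deriv (by rw [wave]; ring)

lemma continuous_wave (κ : ℝ) : Continuous (wave κ) := by
  unfold wave
  fun_prop

attribute [fun_prop] continuous_wave

lemma wave_zero (κ : ℝ) : wave κ 0 = 1 := by simp [wave]

lemma wave_period {L : ℝ} (hL : 0 < L) (n : ℤ) : wave (n / L) (2 * π * L) = 1 := by
  have hL' : (L:ℂ) ≠ 0 := by exact_mod_cast hL.ne'
  rw [wave, Complex.exp_eq_one_iff]
  refine ⟨-n, ?_⟩
  push_cast
  field_simp

/-- Parseval's identity on a period. -/
lemma tsum_enorm_sq_integral_wave {L : ℝ} (hL : 0 < L) {f : ℝ → ℂ} (hf : Continuous f) :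
    ∑' n : ℤ, ‖∫ x in (0:ℝ)..(2 * π * L), wave (n / L) x * f x‖ₑ ^ 2
      = ENNReal.ofReal (2 * π * L) * ∫⁻ x in Ioo 0 (2 * π * L), ‖f x‖ₑ ^ 2 := by
  have hT : 0 < 2 * π * L := by positivity
  have hL' : (L:ℂ) ≠ 0 := by exact_mod_cast hL.ne'
  have hπ' : (π:ℂ) ≠ 0 := by exact_mod_cast Real.pi_ne_zero
  have hmem : MemLp f 2 (volume.restrict (Ioc 0 (2 * π * L))) := by
    obtain ⟨K, hK⟩ := isCompact_Icc.exists_bound_of_continuousOn (s := Icc 0 (2 * π * L))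
      hf.continuousOn
    exact MemLp.of_bound hf.aestronglyMeasurable K ((ae_restrict_iff' measurableSet_Ioc).2
      (ae_of_all _ fun x hx => hK x ⟨hx.1.le, hx.2⟩))
  have h := hasSum_sq_fourierCoeffOn hT hmem
  have hc : ∀ n : ℤ, ∫ x in (0:ℝ)..(2 * π * L), wave (n / L) x * f x
      = (2 * π * L : ℝ) • fourierCoeffOn hT f n := by
    intro n
    rw [fourierCoeffOn_eq_integral, smul_smul, sub_zero, mul_one_div_cancel hT.ne', one_smul]
    refine intervalIntegral.integral_congr fun x _ => ?_
    simp only [fourier_coe_apply, smul_eq_mul, wave]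
    congr 2
    push_cast
    field_simp
  have h2 : ∀ n : ℤ, ‖∫ x in (0:ℝ)..(2 * π * L), wave (n / L) x * f x‖ₑ ^ 2
      = ENNReal.ofReal ((2 * π * L) ^ 2 * ‖fourierCoeffOn hT f n‖ ^ 2) := by
    intro n
    rw [hc, ← ofReal_norm, ← ENNReal.ofReal_pow (norm_nonneg _), norm_smul, mul_pow,
      Real.norm_of_nonneg hT.le]
  simp only [h2]
  have hs := h.mul_left ((2 * π * L) ^ 2)
  rw [← ENNReal.ofReal_tsum_of_nonneg (fun n => by positivity) hs.summable, hs.tsum_eq, sub_zero,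
    smul_eq_mul, sq, mul_assoc, mul_inv_cancel_left₀ hT.ne', ENNReal.ofReal_mul hT.le,
    intervalIntegral.integral_of_le hT.le, integral_Ioc_eq_integral_Ioo,
    ofReal_integral_eq_lintegral_ofReal]
  · congr 1
    refine lintegral_congr fun x => ?_
    rw [← ofReal_norm, ENNReal.ofReal_pow (norm_nonneg _)]
  · exact ((hf.norm.pow 2).integrableOn_Icc).mono_set Ioo_subset_Icc_self
  · exact ae_of_all _ fun x => by positivity

/-- Differentiation under the integral sign for jointly continuous data. -/
lemma hasDerivAt_intervalIntegral {F F' : ℝ → ℝ → ℂ} (hF : Continuous F.uncurry)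
    (hF' : Continuous F'.uncurry) (hd : ∀ s t, HasDerivAt (fun s => F s t) (F' s t) s)
    (a b s : ℝ) :
    HasDerivAt (fun s => ∫ t in a..b, F s t) (∫ t in a..b, F' s t) s := by
  obtain ⟨K, hK⟩ := (isCompact_Icc.prod isCompact_uIcc).exists_bound_of_continuousOn
    (s := Icc (s - 1) (s + 1) ×ˢ uIcc a b) hF'.continuousOn
  have hc : ∀ s, Continuous (F s) := fun s =>
    hF.comp (continuous_const.prodMk continuous_id)
  have hc' : ∀ s, Continuous (F' s) := fun s =>
    hF'.comp (continuous_const.prodMk continuous_id)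
  refine (intervalIntegral.hasDerivAt_integral_of_dominated_loc_of_deriv_le (F := F) (F' := F')
    (s := Icc (s - 1) (s + 1)) (bound := fun _ => K)
    (Icc_mem_nhds (by linarith) (by linarith))
    (Eventually.of_forall fun s => (hc s).aestronglyMeasurable) ((hc s).intervalIntegrable _ _)
    (hc' s).aestronglyMeasurable
    (ae_of_all _ fun t ht x hx => hK (x, t) ⟨hx, uIoc_subset_uIcc ht⟩)
    intervalIntegrable_const (ae_of_all _ fun t _ x _ => hd x t)).2

/-- Fourier mode on the rectangle `[0, a] × [0, b]`. -/
def mode (a b κ₁ κ₂ : ℝ) (h : ℝ → ℝ → ℂ) : ℂ :=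
  ∫ x in (0:ℝ)..a, wave κ₁ x * ∫ y in (0:ℝ)..b, wave κ₂ y * h x y

lemma continuous_mode_inner {h : ℝ → ℝ → ℂ} (hh : Continuous h.uncurry) (b κ : ℝ) :
    Continuous fun x => ∫ y in (0:ℝ)..b, wave κ y * h x y := by
  refine intervalIntegral.continuous_parametric_intervalIntegral_of_continuous' ?_ _ _
  exact ((continuous_wave κ).comp continuous_snd).mul hh

lemma mode_add {a b κ₁ κ₂ : ℝ} {h h' : ℝ → ℝ → ℂ} (hh : Continuous h.uncurry)
    (hh' : Continuous h'.uncurry) :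
    mode a b κ₁ κ₂ (fun x y => h x y + h' x y) = mode a b κ₁ κ₂ h + mode a b κ₁ κ₂ h' := by
  have hc : ∀ x, Continuous (h x) := fun x => hh.comp (continuous_const.prodMk continuous_id)
  have hc' : ∀ x, Continuous (h' x) := fun x => hh'.comp (continuous_const.prodMk continuous_id)
  have i := continuous_mode_inner hh b κ₂
  have i' := continuous_mode_inner hh' b κ₂
  unfold mode
  rw [← intervalIntegral.integral_add]
  · refine intervalIntegral.integral_congr fun x _ => ?_
    have hx := hc x
    have hx' := hc' x
    simp only
    rw [← mul_add, ← intervalIntegral.integral_add]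
    · simp only [mul_add]
    · apply Continuous.intervalIntegrable; fun_prop
    · apply Continuous.intervalIntegrable; fun_prop
  · apply Continuous.intervalIntegrable; fun_prop
  · apply Continuous.intervalIntegrable; fun_prop

lemma integral_wave_mul_deriv {κ a : ℝ} (ha : wave κ a = 1) {c c' : ℝ → ℂ}
    (hc' : Continuous c') (hd : ∀ x, HasDerivAt c (c' x) x) (hp : c a = c 0) :
    ∫ x in (0:ℝ)..a, wave κ x * c' x = κ * Complex.I * ∫ x in (0:ℝ)..a, wave κ x * c x := by
  have hc : Continuous c := continuous_iff_continuousAt.2 fun x => (hd x).continuousAt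
  rw [intervalIntegral.integral_mul_deriv_eq_deriv_mul (fun x _ => hasDerivAt_wave κ x)
    (fun x _ => hd x) (by apply Continuous.intervalIntegrable; fun_prop)
    (hc'.intervalIntegrable _ _), ha, wave_zero, hp, sub_self, zero_sub,
    ← intervalIntegral.integral_neg, ← intervalIntegral.integral_const_mul]
  refine intervalIntegral.integral_congr fun x _ => ?_
  ring

lemma mode_deriv_fst {a b κ₁ κ₂ : ℝ} (ha : wave κ₁ a = 1) {h h' : ℝ → ℝ → ℂ}
    (hh : Continuous h.uncurry) (hh' : Continuous h'.uncurry)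
    (hd : ∀ x y, HasDerivAt (fun x => h x y) (h' x y) x) (hp : ∀ y, h a y = h 0 y) :
    mode a b κ₁ κ₂ h' = κ₁ * Complex.I * mode a b κ₁ κ₂ h := by
  refine integral_wave_mul_deriv ha (continuous_mode_inner hh' b κ₂) (fun x => ?_) (by simp [hp])
  exact hasDerivAt_intervalIntegral (F := fun x y => wave κ₂ y * h x y)
    (F' := fun x y => wave κ₂ y * h' x y)
    (((continuous_wave κ₂).comp continuous_snd).mul hh)
    (((continuous_wave κ₂).comp continuous_snd).mul hh')
    (fun x y => (hd x y).const_mul _) 0 b x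

lemma mode_deriv_snd {a b κ₁ κ₂ : ℝ} (hb : wave κ₂ b = 1) {h h' : ℝ → ℝ → ℂ}
    (hh' : Continuous h'.uncurry)
    (hd : ∀ x y, HasDerivAt (h x) (h' x y) y) (hp : ∀ x, h x b = h x 0) :
    mode a b κ₁ κ₂ h' = κ₂ * Complex.I * mode a b κ₁ κ₂ h := by
  unfold mode
  rw [← intervalIntegral.integral_const_mul]
  refine intervalIntegral.integral_congr fun x _ => ?_
  rw [integral_wave_mul_deriv (c' := h' x) hb (hh'.comp (continuous_const.prodMk continuous_id))
    (hd x) (hp x)]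
  ring

lemma continuous_mode {h : ℝ → ℝ → ℝ → ℂ}
    (hh : Continuous fun p : ℝ × ℝ × ℝ => h p.1 p.2.1 p.2.2) (a b κ₁ κ₂ : ℝ) :
    Continuous fun z => mode a b κ₁ κ₂ (h z) := by
  refine intervalIntegral.continuous_parametric_intervalIntegral_of_continuous' ?_ _ _
  refine ((continuous_wave κ₁).comp continuous_snd).mul ?_
  refine intervalIntegral.continuous_parametric_intervalIntegral_of_continuous'
    (f := fun (p : ℝ × ℝ) y => wave κ₂ y * h p.1 p.2 y) ?_ _ _
  refine ((continuous_wave κ₂).comp continuous_snd).mul ?_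
  exact hh.comp (continuous_fst.fst.prodMk (continuous_fst.snd.prodMk continuous_snd))

lemma hasDerivAt_mode {h h' : ℝ → ℝ → ℝ → ℂ}
    (hh : Continuous fun p : ℝ × ℝ × ℝ => h p.1 p.2.1 p.2.2)
    (hh' : Continuous fun p : ℝ × ℝ × ℝ => h' p.1 p.2.1 p.2.2)
    (hd : ∀ z x y, HasDerivAt (fun z => h z x y) (h' z x y) z) (a b κ₁ κ₂ z : ℝ) :
    HasDerivAt (fun z => mode a b κ₁ κ₂ (h z)) (mode a b κ₁ κ₂ (h' z)) z := by
  have key : ∀ f : ℝ → ℝ → ℝ → ℂ, (Continuous fun p : ℝ × ℝ × ℝ => f p.1 p.2.1 p.2.2) →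
      Continuous (fun p : ℝ × ℝ => wave κ₁ p.2 * ∫ y in (0:ℝ)..b, wave κ₂ y * f p.1 p.2 y) := by
    intro f hf
    refine ((continuous_wave κ₁).comp continuous_snd).mul ?_
    refine intervalIntegral.continuous_parametric_intervalIntegral_of_continuous'
      (f := fun (p : ℝ × ℝ) y => wave κ₂ y * f p.1 p.2 y) ?_ _ _
    refine ((continuous_wave κ₂).comp continuous_snd).mul ?_
    exact hf.comp (continuous_fst.fst.prodMk (continuous_fst.snd.prodMk continuous_snd))
  have key2 : ∀ f : ℝ → ℝ → ℝ → ℂ, (Continuous fun p : ℝ × ℝ × ℝ => f p.1 p.2.1 p.2.2) → ∀ x,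
      Continuous (fun p : ℝ × ℝ => wave κ₂ p.2 * f p.1 x p.2) := by
    intro f hf x
    refine ((continuous_wave κ₂).comp continuous_snd).mul ?_
    exact hf.comp (continuous_fst.prodMk (continuous_const.prodMk continuous_snd))
  refine hasDerivAt_intervalIntegral
    (F := fun z x => wave κ₁ x * ∫ y in (0:ℝ)..b, wave κ₂ y * h z x y)
    (F' := fun z x => wave κ₁ x * ∫ y in (0:ℝ)..b, wave κ₂ y * h' z x y)
    (key h hh) (key h' hh') (fun z x => HasDerivAt.const_mul _ ?_) 0 a z
  exact hasDerivAt_intervalIntegral (F := fun z y => wave κ₂ y * h z x y)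
    (F' := fun z y => wave κ₂ y * h' z x y) (key2 h hh x) (key2 h' hh' x)
    (fun z y => (hd z x y).const_mul _) 0 b z

/-- Parseval's identity on a rectangle. -/
lemma tsum_enorm_sq_mode {L₁ L₂ : ℝ} (hL₁ : 0 < L₁) (hL₂ : 0 < L₂) {h : ℝ → ℝ → ℂ}
    (hh : Continuous h.uncurry) :
    ∑' n : ℤ, ∑' l : ℤ, ‖mode (2 * π * L₁) (2 * π * L₂) (l / L₁) (n / L₂) h‖ₑ ^ 2
      = ENNReal.ofReal (2 * π * L₁) * ENNReal.ofReal (2 * π * L₂) *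
        ∫⁻ x in Ioo 0 (2 * π * L₁), ∫⁻ y in Ioo 0 (2 * π * L₂), ‖h x y‖ₑ ^ 2 := by
  unfold mode
  simp only [fun n : ℤ => tsum_enorm_sq_integral_wave hL₁
    (continuous_mode_inner hh (2 * π * L₂) (n / L₂))]
  rw [ENNReal.tsum_mul_left, ← lintegral_tsum, mul_assoc (ENNReal.ofReal _)]
  · congr 1
    rw [← lintegral_const_mul']
    · refine lintegral_congr fun x => ?_
      exact tsum_enorm_sq_integral_wave hL₂ (hh.comp (continuous_const.prodMk continuous_id))
    · exact ENNReal.ofReal_ne_top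
  · intro n
    exact ((continuous_mode_inner hh _ _).enorm.measurable.pow_const 2).aemeasurable

/-- The horizontal Fourier mode of `f` at height `z`. -/
def fmode (L₁ L₂ : ℝ) (p : ℤ × ℤ) (f : (Fin 3 → ℝ) → ℝ) (z : ℝ) : ℂ :=
  mode (2 * π * L₁) (2 * π * L₂) (p.1 / L₁) (p.2 / L₂) fun x y => (f ![x, y, z] : ℂ)

lemma setLIntegral_cell (L₁ L₂ : ℝ) {G : (Fin 3 → ℝ) → ENNReal} (hG : Measurable G) :
    ∫⁻ x in cell L₁ L₂, G x = ∫⁻ z in Iio 0, ∫⁻ x in Ioo 0 (2 * π * L₁),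
      ∫⁻ y in Ioo 0 (2 * π * L₂), G ![x, y, z] := by
  have h1 := (volume_preserving_piFinSuccAbove (fun _ : Fin 3 => ℝ) 2).symm
  have h2 := ((MeasurePreserving.id (volume : Measure ℝ)).prod
    (volume_preserving_finTwoArrow ℝ)).symm
    ((MeasurableEquiv.refl ℝ).prodCongr MeasurableEquiv.finTwoArrow)
  have hmp := h1.comp h2
  have hemb : MeasurableEmbedding ((MeasurableEquiv.piFinSuccAbove (fun _ : Fin 3 => ℝ) 2).symm ∘
      ((MeasurableEquiv.refl ℝ).prodCongr MeasurableEquiv.finTwoArrow).symm) :=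
    (MeasurableEquiv.measurableEmbedding _).comp (MeasurableEquiv.measurableEmbedding _)
  have hval : ∀ q : ℝ × ℝ × ℝ, ((MeasurableEquiv.piFinSuccAbove (fun _ : Fin 3 => ℝ) 2).symm ∘
      ((MeasurableEquiv.refl ℝ).prodCongr MeasurableEquiv.finTwoArrow).symm) q
      = ![q.2.1, q.2.2, q.1] := by
    intro q
    ext i
    fin_cases i <;> rfl
  have hpre : ((MeasurableEquiv.piFinSuccAbove (fun _ : Fin 3 => ℝ) 2).symm ∘
      ((MeasurableEquiv.refl ℝ).prodCongr MeasurableEquiv.finTwoArrow).symm) ⁻¹' (cell L₁ L₂)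
      = Iio 0 ×ˢ (Ioo 0 (2 * π * L₁) ×ˢ Ioo 0 (2 * π * L₂)) := by
    ext q
    rw [mem_preimage, hval]
    simp only [cell, mem_ofPred_eq, mem_prod, mem_Iio]
    simp
    tauto
  rw [← hmp.setLIntegral_comp_preimage_emb hemb, hpre]
  simp only [hval]
  have hm : Measurable fun q : ℝ × ℝ × ℝ => G ![q.2.1, q.2.2, q.1] := by
    refine hG.comp (measurable_pi_iff.2 fun i => ?_)
    fin_cases i <;> simp <;> fun_prop
  rw [Measure.volume_eq_prod, setLIntegral_prod _ hm.aemeasurable]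
  refine lintegral_congr fun z => ?_
  rw [setLIntegral_prod]
  exact (hm.comp (measurable_const.prodMk measurable_id)).aemeasurable

lemma continuous_slice {f : (Fin 3 → ℝ) → ℝ} (hf : Continuous f) :
    Continuous fun p : ℝ × ℝ × ℝ => (f ![p.2.1, p.2.2, p.1] : ℂ) := by
  refine Complex.continuous_ofReal.comp (hf.comp (continuous_pi fun i => ?_))
  fin_cases i <;> simp <;> fun_prop

lemma continuous_slice_at {f : (Fin 3 → ℝ) → ℝ} (hf : Continuous f) (z : ℝ) :
    Continuous (Function.uncurry fun x y => (f ![x, y, z] : ℂ)) :=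
  (continuous_slice hf).comp (continuous_const.prodMk (continuous_fst.prodMk continuous_snd))

lemma continuous_fmode {f : (Fin 3 → ℝ) → ℝ} (hf : Continuous f) (L₁ L₂ : ℝ) (p : ℤ × ℤ) :
    Continuous (fmode L₁ L₂ p f) :=
  continuous_mode (h := fun z x y => (f ![x, y, z] : ℂ)) (continuous_slice hf) _ _ _ _

lemma hasSum_of_tsum_ofReal {ι : Type*} {F : ι → ℝ} {S : ℝ} (hF : ∀ i, 0 ≤ F i) (hS : 0 ≤ S)
    (h : ∑' i, ENNReal.ofReal (F i) = ENNReal.ofReal S) : HasSum F S := by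
  have := ENNReal.hasSum_toReal (f := fun i => ENNReal.ofReal (F i)) (by
    rw [h]; exact ENNReal.ofReal_ne_top)
  rw [← ENNReal.tsum_toReal_eq (fun _ => ENNReal.ofReal_ne_top), h,
    ENNReal.toReal_ofReal hS] at this
  simpa only [ENNReal.toReal_ofReal (hF _)] using this

lemma tsum_lintegral_fmode {L₁ L₂ : ℝ} (hL₁ : 0 < L₁) (hL₂ : 0 < L₂) {f : (Fin 3 → ℝ) → ℝ}
    (hf : Continuous f) {w : ℝ → ℝ} (hw : Continuous w) (h0 : ∀ z, 0 ≤ w z) :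
    ∑' p : ℤ × ℤ, ∫⁻ z in Iio 0, ENNReal.ofReal (w z * ‖fmode L₁ L₂ p f z‖ ^ 2)
      = ENNReal.ofReal (2 * π * L₁) * ENNReal.ofReal (2 * π * L₂) *
        ∫⁻ x in cell L₁ L₂, ENNReal.ofReal (w (x 2) * f x ^ 2) := by
  have hcf := fun p => continuous_fmode hf L₁ L₂ p
  have hwf : Continuous fun x : Fin 3 → ℝ => w (x 2) * f x ^ 2 := by fun_prop
  rw [← lintegral_tsum (fun p => by have := hcf p; fun_prop),
    setLIntegral_cell L₁ L₂ (by fun_prop), ← lintegral_const_mul']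
  swap
  · exact ENNReal.mul_ne_top ENNReal.ofReal_ne_top ENNReal.ofReal_ne_top
  refine lintegral_congr fun z => ?_
  have e : ∀ (a : ℝ) , 0 ≤ a → ∀ c : ℂ, ENNReal.ofReal (a * ‖c‖ ^ 2)
      = ENNReal.ofReal a * ‖c‖ₑ ^ 2 := fun a ha c => by
    rw [ENNReal.ofReal_mul ha, ENNReal.ofReal_pow (norm_nonneg _), ofReal_norm]
  have h := tsum_enorm_sq_mode hL₁ hL₂ (continuous_slice_at hf z)
  simp only [e _ (h0 z)]
  rw [ENNReal.tsum_mul_left, ENNReal.tsum_prod', ENNReal.tsum_comm]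
  simp only [fmode]
  rw [h, mul_left_comm]
  congr 1
  rw [← lintegral_const_mul' _ _ ENNReal.ofReal_ne_top]
  refine lintegral_congr fun x => ?_
  rw [← lintegral_const_mul' _ _ ENNReal.ofReal_ne_top]
  refine lintegral_congr fun y => ?_
  rw [← e _ (h0 z)]
  simp

lemma integrableOn_fmode_sq {L₁ L₂ : ℝ} (hL₁ : 0 < L₁) (hL₂ : 0 < L₂) {f : (Fin 3 → ℝ) → ℝ}
    (hf : Continuous f) (hi : IntegrableOn (fun x => f x ^ 2) (cell L₁ L₂)) (p : ℤ × ℤ) :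
    IntegrableOn (fun z => ‖fmode L₁ L₂ p f z‖ ^ 2) (Iio 0) := by
  have hcf := continuous_fmode hf L₁ L₂ p
  refine ⟨by fun_prop, ?_⟩
  rw [hasFiniteIntegral_iff_ofReal (ae_of_all _ fun z => by positivity)]
  have h := tsum_lintegral_fmode hL₁ hL₂ hf (w := fun _ => 1) continuous_const
    fun _ => zero_le_one
  simp only [one_mul] at h
  refine (ENNReal.le_tsum (f := fun p =>
    ∫⁻ z in Iio 0, ENNReal.ofReal (‖fmode L₁ L₂ p f z‖ ^ 2)) p).trans_lt ?_
  rw [h]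
  refine ENNReal.mul_lt_top (ENNReal.mul_lt_top ENNReal.ofReal_lt_top ENNReal.ofReal_lt_top) ?_
  have := hi.2
  rwa [hasFiniteIntegral_iff_ofReal (ae_of_all _ fun z => by positivity)] at this

/-- Weighted Parseval identity on the cell. -/
lemma hasSum_integral_fmode {L₁ L₂ : ℝ} (hL₁ : 0 < L₁) (hL₂ : 0 < L₂) {f : (Fin 3 → ℝ) → ℝ}
    (hf : Continuous f) (hi : IntegrableOn (fun x => f x ^ 2) (cell L₁ L₂)) {w : ℝ → ℝ}
    (hw : Continuous w) (h0 : ∀ z, 0 ≤ w z) {K : ℝ} (hK : ∀ z, w z ≤ K) :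
    HasSum (fun p => ∫ z in Iio 0, w z * ‖fmode L₁ L₂ p f z‖ ^ 2)
      ((2 * π * L₁) * (2 * π * L₂) * ∫ x in cell L₁ L₂, w (x 2) * f x ^ 2) := by
  have hcf := fun p => continuous_fmode hf L₁ L₂ p
  have hab : ∀ z, |w z| ≤ K := fun z => by rw [abs_of_nonneg (h0 z)]; exact hK z
  have i1 : IntegrableOn (fun x => w (x 2) * f x ^ 2) (cell L₁ L₂) :=
    Integrable.bdd_mul hi (hw.comp (continuous_apply 2)).aestronglyMeasurable
      (ae_of_all _ fun x => hab (x 2))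
  refine hasSum_of_tsum_ofReal (fun p => integral_nonneg fun z => mul_nonneg (h0 z) (by positivity))
    (mul_nonneg (by positivity) (integral_nonneg fun x => mul_nonneg (h0 _) (by positivity))) ?_
  rw [ENNReal.ofReal_mul (by positivity), ENNReal.ofReal_mul (by positivity),
    ofReal_integral_eq_lintegral_ofReal i1
      (ae_of_all _ fun x => mul_nonneg (h0 _) (by positivity)),
    ← tsum_lintegral_fmode hL₁ hL₂ hf hw h0]
  refine tsum_congr fun p => ofReal_integral_eq_lintegral_ofReal
    (integrableOn_bdd_mul hw hab (integrableOn_fmode_sq hL₁ hL₂ hf hi p))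
    (ae_of_all _ fun x => mul_nonneg (h0 _) (by positivity))

lemma hasSum_fmode_boundary {L₁ L₂ : ℝ} (hL₁ : 0 < L₁) (hL₂ : 0 < L₂) {f : (Fin 3 → ℝ) → ℝ}
    (hf : Continuous f) (z : ℝ) :
    HasSum (fun p => ‖fmode L₁ L₂ p f z‖ ^ 2)
      ((2 * π * L₁) * (2 * π * L₂) * ∫ y in cellΓ L₁ L₂, f ![y.1, y.2, z] ^ 2) := by
  have hc : Continuous fun y : ℝ × ℝ => f ![y.1, y.2, z] := by
    refine hf.comp (continuous_pi fun i => ?_)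
    fin_cases i <;> simp <;> fun_prop
  have i1 : IntegrableOn (fun y : ℝ × ℝ => f ![y.1, y.2, z] ^ 2) (cellΓ L₁ L₂) := by
    refine ((hc.pow 2).continuousOn.integrableOn_compact (K := Icc 0 (2 * π * L₁) ×ˢ
      Icc 0 (2 * π * L₂)) (isCompact_Icc.prod isCompact_Icc)).mono_set ?_
    exact prod_mono Ioo_subset_Icc_self Ioo_subset_Icc_self
  refine hasSum_of_tsum_ofReal (fun p => by positivity)
    (mul_nonneg (by positivity) (integral_nonneg fun x => by positivity)) ?_
  rw [ENNReal.ofReal_mul (by positivity), ENNReal.ofReal_mul (by positivity),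
    ofReal_integral_eq_lintegral_ofReal i1 (ae_of_all _ fun x => by positivity)]
  have h := tsum_enorm_sq_mode hL₁ hL₂ (continuous_slice_at hf z)
  have e : ∀ c : ℂ, ENNReal.ofReal (‖c‖ ^ 2) = ‖c‖ₑ ^ 2 := fun c => by
    rw [ENNReal.ofReal_pow (norm_nonneg _), ofReal_norm]
  simp only [e]
  rw [ENNReal.tsum_prod', ENNReal.tsum_comm]
  simp only [fmode]
  rw [h, cellΓ, Measure.volume_eq_prod, setLIntegral_prod _ (by fun_prop)]
  simp only [← e]
  simp

lemma continuous_pd {f : (Fin 3 → ℝ) → ℝ} (hf : ContDiff ℝ 1 f) (i : Fin 3) :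
    Continuous (pd i f) :=
  (hf.continuous_fderiv one_ne_zero).clm_apply continuous_const

lemma hasDerivAt_comp_line {f : (Fin 3 → ℝ) → ℝ} (hf : ContDiff ℝ 1 f) {i : Fin 3}
    {γ : ℝ → Fin 3 → ℝ} {t : ℝ} (hγ : HasDerivAt γ (Pi.single i 1) t) :
    HasDerivAt (fun s => (f (γ s) : ℂ)) (pd i f (γ t) : ℂ) t :=
  (((hf.differentiable one_ne_zero _).hasFDerivAt).comp_hasDerivAt t hγ).ofReal_comp

lemma hasDerivAt_slice_fst {f : (Fin 3 → ℝ) → ℝ} (hf : ContDiff ℝ 1 f) (x y z : ℝ) :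
    HasDerivAt (fun x => (f ![x, y, z] : ℂ)) (pd 0 f ![x, y, z] : ℂ) x := by
  refine hasDerivAt_comp_line (γ := fun x => ![x, y, z]) hf (hasDerivAt_pi.2 fun j => ?_)
  fin_cases j <;> simp [hasDerivAt_id', hasDerivAt_const]

lemma hasDerivAt_slice_snd {f : (Fin 3 → ℝ) → ℝ} (hf : ContDiff ℝ 1 f) (x y z : ℝ) :
    HasDerivAt (fun y => (f ![x, y, z] : ℂ)) (pd 1 f ![x, y, z] : ℂ) y := by
  refine hasDerivAt_comp_line (γ := fun y => ![x, y, z]) hf (hasDerivAt_pi.2 fun j => ?_)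
  fin_cases j <;> simp [hasDerivAt_id', hasDerivAt_const]

lemma hasDerivAt_slice_trd {f : (Fin 3 → ℝ) → ℝ} (hf : ContDiff ℝ 1 f) (x y z : ℝ) :
    HasDerivAt (fun z => (f ![x, y, z] : ℂ)) (pd 2 f ![x, y, z] : ℂ) z := by
  refine hasDerivAt_comp_line (γ := fun z => ![x, y, z]) hf (hasDerivAt_pi.2 fun j => ?_)
  fin_cases j <;> simp [hasDerivAt_id', hasDerivAt_const]

lemma fmode_add {L₁ L₂ : ℝ} {p : ℤ × ℤ} {f f' : (Fin 3 → ℝ) → ℝ} (hf : Continuous f)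
    (hf' : Continuous f') (z : ℝ) :
    fmode L₁ L₂ p (fun x => f x + f' x) z = fmode L₁ L₂ p f z + fmode L₁ L₂ p f' z := by
  rw [fmode, fmode, fmode, ← mode_add (continuous_slice_at hf z) (continuous_slice_at hf' z)]
  simp only [Complex.ofReal_add]

lemma fmode_pd_zero {L₁ L₂ : ℝ} (hL₁ : 0 < L₁) {p : ℤ × ℤ} {f : (Fin 3 → ℝ) → ℝ}
    (hf : ContDiff ℝ 1 f) (hper : Periodic3 L₁ L₂ f) (z : ℝ) :
    fmode L₁ L₂ p (pd 0 f) z = (p.1 / L₁ : ℝ) * Complex.I * fmode L₁ L₂ p f z := by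
  refine mode_deriv_fst (wave_period hL₁ p.1) (continuous_slice_at hf.continuous z)
    (continuous_slice_at (continuous_pd hf 0) z) (fun x y => hasDerivAt_slice_fst hf x y z)
    fun y => ?_
  rw [← (hper ![0, y, z]).1]
  congr 2
  ext j
  fin_cases j <;> simp

lemma fmode_pd_one {L₁ L₂ : ℝ} (hL₂ : 0 < L₂) {p : ℤ × ℤ} {f : (Fin 3 → ℝ) → ℝ}
    (hf : ContDiff ℝ 1 f) (hper : Periodic3 L₁ L₂ f) (z : ℝ) :
    fmode L₁ L₂ p (pd 1 f) z = (p.2 / L₂ : ℝ) * Complex.I * fmode L₁ L₂ p f z := by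
  refine mode_deriv_snd (wave_period hL₂ p.2)
    (continuous_slice_at (continuous_pd hf 1) z) (fun x y => hasDerivAt_slice_snd hf x y z)
    fun x => ?_
  rw [← (hper ![x, 0, z]).2]
  congr 2
  ext j
  fin_cases j <;> simp

lemma hasDerivAt_fmode {L₁ L₂ : ℝ} {p : ℤ × ℤ} {f : (Fin 3 → ℝ) → ℝ}
    (hf : ContDiff ℝ 1 f) (z : ℝ) :
    HasDerivAt (fmode L₁ L₂ p f) (fmode L₁ L₂ p (pd 2 f) z) z :=
  hasDerivAt_mode (h := fun z x y => (f ![x, y, z] : ℂ))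
    (h' := fun z x y => (pd 2 f ![x, y, z] : ℂ)) (continuous_slice hf.continuous)
    (continuous_slice (continuous_pd hf 2)) (fun z x y => hasDerivAt_slice_trd hf x y z) _ _ _ _ _

/-- The profile of a divergence-free mode, recovered from its horizontal components. -/
def Profile.ofDivFree (k₁ k₂ : ℝ) (f a b a' b' : ℝ → ℝ) (cf : Continuous f) (ca' : Continuous a')
    (cb' : Continuous b') (da : ∀ x, HasDerivAt a (a' x) x) (db : ∀ x, HasDerivAt b (b' x) x)
    (df : ∀ x < 0, HasDerivAt f (k₁ * a x + k₂ * b x) x)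
    (hf : IntegrableOn (fun x => f x ^ 2) (Iio 0)) (ha : IntegrableOn (fun x => a x ^ 2) (Iio 0))
    (hb : IntegrableOn (fun x => b x ^ 2) (Iio 0)) (ha' : IntegrableOn (fun x => a' x ^ 2) (Iio 0))
    (hb' : IntegrableOn (fun x => b' x ^ 2) (Iio 0)) : Profile where
  f := f
  f1 x := k₁ * a x + k₂ * b x
  f2 x := k₁ * a' x + k₂ * b' x
  c0 := cf
  c1 := ((continuous_iff_continuousAt.2 fun x => (da x).continuousAt).const_mul _).add
    ((continuous_iff_continuousAt.2 fun x => (db x).continuousAt).const_mul _)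
  c2 := (ca'.const_mul _).add (cb'.const_mul _)
  d0 := df
  d1 x _ := ((da x).const_mul _).add ((db x).const_mul _)
  i0 := hf
  i1 := integrableOn_sq_add
    ((continuous_iff_continuousAt.2 fun x => (da x).continuousAt).const_mul _)
    (continuous_iff_continuousAt.2 fun x => (db x).continuousAt)
    (integrableOn_mul_sq continuous_const (fun _ => le_rfl) ha) hb _
  i2 := integrableOn_sq_add (ca'.const_mul _) cb'
    (integrableOn_mul_sq continuous_const (fun _ => le_rfl) ha') hb' _

lemma integrableOn_re_sq {F : ℝ → ℂ} {s : Set ℝ} (hF : Continuous F)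
    (hi : IntegrableOn (fun z => ‖F z‖ ^ 2) s) : IntegrableOn (fun z => (F z).re ^ 2) s := by
  refine Integrable.mono' hi ((Complex.continuous_re.comp hF).pow 2).aestronglyMeasurable
    (ae_of_all _ fun z => ?_)
  rw [Real.norm_of_nonneg (sq_nonneg _), Complex.sq_norm, Complex.normSq_apply]
  nlinarith [mul_self_nonneg (F z).im]

lemma integrableOn_im_sq {F : ℝ → ℂ} {s : Set ℝ} (hF : Continuous F)
    (hi : IntegrableOn (fun z => ‖F z‖ ^ 2) s) : IntegrableOn (fun z => (F z).im ^ 2) s := by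
  refine Integrable.mono' hi ((Complex.continuous_im.comp hF).pow 2).aestronglyMeasurable
    (ae_of_all _ fun z => ?_)
  rw [Real.norm_of_nonneg (sq_nonneg _), Complex.sq_norm, Complex.normSq_apply]
  nlinarith [mul_self_nonneg (F z).re]

lemma integrableOn_norm_add_sq {F G : ℝ → ℂ} {s : Set ℝ} (hF : Continuous F) (hG : Continuous G)
    (hiF : IntegrableOn (fun z => ‖F z‖ ^ 2) s) (hiG : IntegrableOn (fun z => ‖G z‖ ^ 2) s) :
    IntegrableOn (fun z => ‖F z + G z‖ ^ 2) s := by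
  refine Integrable.mono' ((hiF.add hiG).const_mul 2)
    ((hF.add hG).norm.pow 2).aestronglyMeasurable (ae_of_all _ fun z => ?_)
  rw [Real.norm_of_nonneg (sq_nonneg _)]
  have := pow_le_pow_left₀ (norm_nonneg _) (norm_add_le (F z) (G z)) 2
  simp only [Pi.add_apply]
  nlinarith [sq_nonneg (‖F z‖ - ‖G z‖)]

lemma hasDerivAt_re {F : ℝ → ℂ} {F' : ℂ} {x : ℝ} (h : HasDerivAt F F' x) :
    HasDerivAt (fun t => (F t).re) F'.re x :=
  Complex.reCLM.hasFDerivAt.comp_hasDerivAt x h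

lemma hasDerivAt_im {F : ℝ → ℂ} {F' : ℂ} {x : ℝ} (h : HasDerivAt F F' x) :
    HasDerivAt (fun t => (F t).im) F'.im x :=
  Complex.imCLM.hasFDerivAt.comp_hasDerivAt x h

lemma sq_lincomb_le (k₁ k₂ a b : ℝ) :
    (k₁ * a + k₂ * b) ^ 2 ≤ (k₁ ^ 2 + k₂ ^ 2) * (a ^ 2 + b ^ 2) := by
  nlinarith [sq_nonneg (k₁ * b - k₂ * a)]

/-- Pointwise bound for the viscous part of one real component of a divergence-free mode. -/
lemma dissipation_le (k₁ k₂ f a b a' b' : ℝ) :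
    (k₁ * a' + k₂ * b' + (k₁ ^ 2 + k₂ ^ 2) * f) ^ 2
        + 4 * (k₁ ^ 2 + k₂ ^ 2) * (k₁ * a + k₂ * b) ^ 2
      ≤ (k₁ ^ 2 + k₂ ^ 2) / 2 * (4 * (k₁ * a) ^ 2 + 4 * (k₂ * b) ^ 2
        + 2 * (k₁ * b + k₂ * a) ^ 2 + 2 * (k₁ * f + a') ^ 2 + 2 * (k₂ * f + b') ^ 2
        + 4 * (k₁ * a + k₂ * b) ^ 2) := by
  have h1 := sq_lincomb_le k₁ k₂ (k₁ * f + a') (k₂ * f + b')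
  have h2 : 2 * (k₁ * a + k₂ * b) ^ 2
      ≤ 2 * (k₁ * a) ^ 2 + 2 * (k₂ * b) ^ 2 + (k₁ * b + k₂ * a) ^ 2 := by
    nlinarith [sq_nonneg (k₁ * b - k₂ * a)]
  have h3 := mul_le_mul_of_nonneg_left h2 (add_nonneg (sq_nonneg k₁) (sq_nonneg k₂))
  linear_combination h1 + h3

namespace Medium

variable (m : Medium)

/-- The stability inequality for a single divergence-free Fourier mode. -/
lemma mode_inequality {Λ : ℝ} (hΛ : 0 < Λ)
    (h : ∀ lam, IsCharValue m.μ m.g m.k m.ρp m.ρ lam → lam ≤ Λ) {k₁ k₂ : ℝ}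
    (hk : m.k ^ 2 = k₁ ^ 2 + k₂ ^ 2) {U : Fin 3 → ℝ → ℂ} {G : Fin 3 → Fin 3 → ℝ → ℂ}
    (cG : ∀ i j, Continuous (G i j)) (hG0 : ∀ j z, G 0 j z = k₁ * Complex.I * U j z)
    (hG1 : ∀ j z, G 1 j z = k₂ * Complex.I * U j z)
    (hG2 : ∀ j z, HasDerivAt (U j) (G 2 j z) z)
    (hdiv : ∀ z < 0, G 0 0 z + G 1 1 z + G 2 2 z = 0)
    (hU : ∀ j, IntegrableOn (fun z => ‖U j z‖ ^ 2) (Iio 0))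
    (hG : ∀ i j, IntegrableOn (fun z => ‖G i j z‖ ^ 2) (Iio 0)) :
    ∫ z in Iio 0, m.g * m.r z * ‖U 2 z‖ ^ 2 ≤ m.g * m.ρp * ‖U 2 0‖ ^ 2
      + Λ ^ 2 * (∑ j, ∫ z in Iio 0, m.ρ z * ‖U j z‖ ^ 2)
      + Λ / 2 * (∑ i, ∑ j, ∫ z in Iio 0, m.μ * ‖G i j z + G j i z‖ ^ 2) := by
  have cU : ∀ j, Continuous (U j) := fun j =>
    continuous_iff_continuousAt.2 fun z => (hG2 j z).continuousAt
  have hv : ∀ z < 0, G 2 2 z = -(k₁ * Complex.I * U 0 z + k₂ * Complex.I * U 1 z) := fun z hz => by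
    rw [← hG0, ← hG1]
    linear_combination hdiv z hz
  let p := Profile.ofDivFree k₁ k₂ (fun z => (U 2 z).re) (fun z => (U 0 z).im)
    (fun z => (U 1 z).im) (fun z => (G 2 0 z).im) (fun z => (G 2 1 z).im)
    (Complex.continuous_re.comp (cU 2)) (Complex.continuous_im.comp (cG 2 0))
    (Complex.continuous_im.comp (cG 2 1)) (fun z => hasDerivAt_im (hG2 0 z))
    (fun z => hasDerivAt_im (hG2 1 z))
    (fun z hz => (hasDerivAt_re (hG2 2 z)).congr_deriv (by simp [hv z hz]; ring))
    (integrableOn_re_sq (cU 2) (hU 2)) (integrableOn_im_sq (cU 0) (hU 0))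
    (integrableOn_im_sq (cU 1) (hU 1)) (integrableOn_im_sq (cG 2 0) (hG 2 0))
    (integrableOn_im_sq (cG 2 1) (hG 2 1))
  let q := Profile.ofDivFree (-k₁) (-k₂) (fun z => (U 2 z).im) (fun z => (U 0 z).re)
    (fun z => (U 1 z).re) (fun z => (G 2 0 z).re) (fun z => (G 2 1 z).re)
    (Complex.continuous_im.comp (cU 2)) (Complex.continuous_re.comp (cG 2 0))
    (Complex.continuous_re.comp (cG 2 1)) (fun z => hasDerivAt_re (hG2 0 z))
    (fun z => hasDerivAt_re (hG2 1 z))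
    (fun z hz => (hasDerivAt_im (hG2 2 z)).congr_deriv (by simp [hv z hz]; ring))
    (integrableOn_im_sq (cU 2) (hU 2)) (integrableOn_re_sq (cU 0) (hU 0))
    (integrableOn_re_sq (cU 1) (hU 1)) (integrableOn_re_sq (cG 2 0) (hG 2 0))
    (integrableOn_re_sq (cG 2 1) (hG 2 1))
  have hp := m.form_nonneg hΛ h p
  have hq := m.form_nonneg hΛ h q
  rw [form_self] at hp hq
  have sqn : ∀ c : ℂ, ‖c‖ ^ 2 = c.re ^ 2 + c.im ^ 2 := fun c => by
    rw [Complex.sq_norm, Complex.normSq_apply]; ring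
  have hk0 : 0 < m.k ^ 2 := pow_pos m.k_pos 2
  have iU : ∀ j, IntegrableOn (fun z => m.ρ z * ‖U j z‖ ^ 2) (Iio 0) := fun j =>
    integrableOn_bdd_mul m.ρ_cont m.abs_ρ_le (hU j)
  have iS : ∀ i j, IntegrableOn (fun z => m.μ * ‖G i j z + G j i z‖ ^ 2) (Iio 0) := fun i j =>
    (integrableOn_norm_add_sq (cG i j) (cG j i) (hG i j) (hG j i)).const_mul _
  have hA : m.A p + m.A q ≤ m.k ^ 2 * ∑ j, ∫ z in Iio 0, m.ρ z * ‖U j z‖ ^ 2 := by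
    unfold A
    rw [← integral_add (m.int_A p) (m.int_A q), ← integral_finsetSum _ fun j _ => iU j,
      ← integral_const_mul]
    refine setIntegral_mono ((m.int_A p).add (m.int_A q))
      ((integrable_finsetSum _ fun j _ => iU j).const_mul _) fun z => ?_
    have h1 := sq_lincomb_le k₁ k₂ (U 0 z).im (U 1 z).im
    have h2 := sq_lincomb_le (-k₁) (-k₂) (U 0 z).re (U 1 z).re
    have hρ : 0 ≤ m.ρ z := m.ρm_pos.le.trans (m.ρm_le z)
    have h3 := mul_le_mul_of_nonneg_left (add_le_add h1 h2) hρ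
    simp only [p, q, Profile.ofDivFree, Fin.sum_univ_three, sqn, hk]
    linear_combination h3
  have hB : m.B p + m.B q
      ≤ m.k ^ 2 / 2 * ∑ i, ∑ j, ∫ z in Iio 0, m.μ * ‖G i j z + G j i z‖ ^ 2 := by
    unfold B
    simp only [← integral_finsetSum _ fun j _ => iS _ j]
    rw [← integral_add (m.int_B p) (m.int_B q),
      ← integral_finsetSum _ fun i _ => integrable_finsetSum _ fun j _ => iS i j,
      ← integral_const_mul]
    refine setIntegral_mono_on ((m.int_B p).add (m.int_B q))
      ((integrable_finsetSum _ fun i _ => integrable_finsetSum _ fun j _ => iS i j).const_mul _)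
      measurableSet_Iio fun z hz => ?_
    have h1 := dissipation_le k₁ k₂ (U 2 z).re (U 0 z).im (U 1 z).im (G 2 0 z).im (G 2 1 z).im
    have h2 := dissipation_le (-k₁) (-k₂) (U 2 z).im (U 0 z).re (U 1 z).re (G 2 0 z).re
      (G 2 1 z).re
    have h3 := mul_le_mul_of_nonneg_left (add_le_add h1 h2) m.μ_pos.le
    simp only [p, q, Profile.ofDivFree, Fin.sum_univ_three, sqn, hk]
    simp only [hG0, hG1, hv z hz, Complex.add_re, Complex.add_im, Complex.mul_re, Complex.mul_im,
      Complex.neg_re, Complex.neg_im, Complex.ofReal_re, Complex.ofReal_im, Complex.I_re,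
      Complex.I_im]
    linear_combination h3
  have hC : m.C p + m.C q = m.k ^ 2 * ∫ z in Iio 0, m.g * m.r z * ‖U 2 z‖ ^ 2 := by
    unfold C
    rw [← integral_add (m.int_C p) (m.int_C q), ← integral_const_mul]
    refine integral_congr_ae (ae_of_all _ fun z => ?_)
    simp only [p, q, Profile.ofDivFree, sqn]
    ring
  have hD : m.D p + m.D q = m.k ^ 2 * (m.g * m.ρp * ‖U 2 0‖ ^ 2) := by
    simp only [D, p, q, Profile.ofDivFree, sqn]
    ring
  have hA' := mul_le_mul_of_nonneg_left hA (sq_nonneg Λ)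
  have hB' := mul_le_mul_of_nonneg_left hB hΛ.le
  refine le_of_mul_le_mul_left ?_ hk0
  linear_combination hp + hq + hA' + hB' - hC + hD

end Medium

/-- A square integrable function with vanishing derivative is zero. -/
lemma eq_zero_of_hasDerivAt_zero {U : ℝ → ℂ} (hd : ∀ z < 0, HasDerivAt U 0 z)
    (hi : IntegrableOn (fun z => ‖U z‖ ^ 2) (Iio 0)) {z : ℝ} (hz : z < 0) : U z = 0 := by
  have hc : ∀ y < 0, U y = U z := fun y hy =>
    (convex_Iio (0:ℝ)).is_const_of_fderivWithin_eq_zero (𝕜 := ℝ)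
      (fun t ht => (hd t ht).differentiableAt.differentiableWithinAt) (fun t ht => by
        rw [fderivWithin_of_isOpen isOpen_Iio ht]
        ext
        simpa using (hd t ht).deriv) hy hz
  have hi' : IntegrableOn (fun _ : ℝ => ‖U z‖ ^ 2) (Iio 0) :=
    hi.congr_fun (fun y hy => by simp only [hc y hy]) measurableSet_Iio
  rw [integrableOn_const_iff] at hi'
  simpa using hi'

lemma exists_medium {μ g a ρm ρp : ℝ} {ρ₀ : ℝ → ℝ} (hμ : 0 < μ) (hg : 0 < g)
    (hρm : 0 < ρm) (hρ₀ : ContDiff ℝ 1 ρ₀) (hmono : ∀ x ≤ (0 : ℝ), 0 ≤ deriv ρ₀ x)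
    (hsupp : tsupport (deriv ρ₀) = Icc (-a) 0) (hflat : ∀ x ≤ -a, ρ₀ x = ρm) (hρp : ρ₀ 0 = ρp)
    {k : ℝ} (hk : 0 < k) :
    ∃ m : Medium, m.k = k ∧ m.μ = μ ∧ m.g = g ∧ m.ρp = ρp ∧ m.ρ = ρ₀ ∧ m.r = deriv ρ₀ := by
  have hz : ∀ x ∉ Icc (-a) 0, deriv ρ₀ x = 0 := fun x hx =>
    image_eq_zero_of_notMem_tsupport (hsupp ▸ hx)
  have hd : Differentiable ℝ ρ₀ := hρ₀.differentiable one_ne_zero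
  have hc : Continuous (deriv ρ₀) := hρ₀.continuous_deriv le_rfl
  have hnn : ∀ x, 0 ≤ deriv ρ₀ x := fun x => by
    rcases le_or_gt x 0 with h | h
    · exact hmono x h
    · exact (hz x fun hx => absurd hx.2 (not_le.2 h)).ge
  have hm : Monotone ρ₀ := monotone_of_deriv_nonneg hd hnn
  obtain ⟨K, hK⟩ := isCompact_Icc.exists_bound_of_continuousOn (s := Icc (-a) 0) hc.continuousOn
  refine ⟨{
    k := k, μ := μ, g := g, ρm := ρm, ρp := ρp, a := a, M := max K 0, ρ := ρ₀, r := deriv ρ₀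
    k_pos := hk
    μ_pos := hμ
    g_pos := hg
    ρm_pos := hρm
    r_cont := hc
    hasDeriv := fun x => (hd x).hasDerivAt
    r_nonneg := hnn
    r_le := fun x => ?_
    r_zero := fun x hx => hz x fun h => absurd h.1 (not_le.2 hx)
    ρm_le := fun x => ?_
    le_ρp := fun x => ?_
    ρ_zero := hρp }, rfl, rfl, rfl, rfl, rfl, rfl⟩
  · by_cases hx : x ∈ Icc (-a) 0
    · exact (le_abs_self _).trans ((hK x hx).trans (le_max_left _ _))
    · exact (hz x hx).le.trans (le_max_right _ _)
  · rcases le_or_gt x (-a) with h | h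
    · exact (hflat x h).ge
    · exact (hflat (-a) le_rfl).ge.trans (hm h.le)
  · rw [← hρp]
    rcases le_or_gt x 0 with h | h
    · exact hm h
    · refine antitoneOn_of_deriv_nonpos (convex_Ici 0) hρ₀.continuous.continuousOn
        hd.differentiableOn (fun y hy => ?_) self_mem_Ici h.le h.le
      rw [interior_Ici] at hy
      exact (hz y fun hx => absurd hx.2 (not_le.2 hy)).le

lemma fmode_inequality {L₁ L₂ μ g ρp Λ : ℝ} {ρ₀ : ℝ → ℝ} (hL₁ : 0 < L₁) (hL₂ : 0 < L₂)
    (hΛpos : 0 < Λ)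
    (hmed : ∀ k > 0,
      ∃ m : Medium, m.k = k ∧ m.μ = μ ∧ m.g = g ∧ m.ρp = ρp ∧ m.ρ = ρ₀ ∧ m.r = deriv ρ₀)
    (hΛ : ∀ k₁ k₂ lam : ℝ, (∃ m : ℤ, k₁ = m / L₁) → (∃ m : ℤ, k₂ = m / L₂) →
      ¬(k₁ = 0 ∧ k₂ = 0) → IsCharValue μ g (√(k₁ ^ 2 + k₂ ^ 2)) ρp ρ₀ lam → lam ≤ Λ)
    {u : (Fin 3 → ℝ) → Fin 3 → ℝ} (hu : ∀ i, ContDiff ℝ 1 fun x => u x i)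
    (hper : ∀ i, Periodic3 L₁ L₂ fun x => u x i)
    (hi : ∀ i, IntegrableOn (fun x => u x i ^ 2) (cell L₁ L₂))
    (hdi : ∀ i j, IntegrableOn (fun x => pd j (fun y => u y i) x ^ 2) (cell L₁ L₂))
    (hdiv : ∀ x : Fin 3 → ℝ, x 2 < 0 → ∑ i, pd i (fun y => u y i) x = 0) (p : ℤ × ℤ) :
    ∫ z in Iio 0, g * deriv ρ₀ z * ‖fmode L₁ L₂ p (fun x => u x 2) z‖ ^ 2
      ≤ g * ρp * ‖fmode L₁ L₂ p (fun x => u x 2) 0‖ ^ 2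
        + Λ ^ 2 * (∑ j, ∫ z in Iio 0, ρ₀ z * ‖fmode L₁ L₂ p (fun x => u x j) z‖ ^ 2)
        + Λ / 2 * (∑ i, ∑ j, ∫ z in Iio 0, μ * ‖fmode L₁ L₂ p
            (fun x => pd i (fun y => u y j) x + pd j (fun y => u y i) x) z‖ ^ 2) := by
  have cpd : ∀ i j, Continuous (pd i fun y => u y j) := fun i j => continuous_pd (hu j) i
  have hG0 : ∀ j z, fmode L₁ L₂ p (pd 0 fun y => u y j) z
      = (p.1 / L₁ : ℝ) * Complex.I * fmode L₁ L₂ p (fun x => u x j) z := fun j z =>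
    fmode_pd_zero hL₁ (hu j) (hper j) z
  have hG1 : ∀ j z, fmode L₁ L₂ p (pd 1 fun y => u y j) z
      = (p.2 / L₂ : ℝ) * Complex.I * fmode L₁ L₂ p (fun x => u x j) z := fun j z =>
    fmode_pd_one hL₂ (hu j) (hper j) z
  have hG2 : ∀ j z, HasDerivAt (fmode L₁ L₂ p fun x => u x j)
      (fmode L₁ L₂ p (pd 2 fun y => u y j) z) z := fun j z => hasDerivAt_fmode (hu j) z
  have hdiv' : ∀ z < 0, fmode L₁ L₂ p (pd 0 fun y => u y 0) z
      + fmode L₁ L₂ p (pd 1 fun y => u y 1) z + fmode L₁ L₂ p (pd 2 fun y => u y 2) z = 0 := by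
    intro z hz
    rw [← fmode_add (cpd 0 0) (cpd 1 1),
      ← fmode_add (f := fun x => pd 0 (fun y => u y 0) x + pd 1 (fun y => u y 1) x)
        ((cpd 0 0).add (cpd 1 1)) (cpd 2 2)]
    have e : ∀ x y, pd 0 (fun y => u y 0) ![x, y, z] + pd 1 (fun y => u y 1) ![x, y, z]
        + pd 2 (fun y => u y 2) ![x, y, z] = 0 := fun x y => by
      rw [← hdiv ![x, y, z] (by simpa using hz), Fin.sum_univ_three]
    simp [fmode, e, mode]
  have hU : ∀ j, IntegrableOn (fun z => ‖fmode L₁ L₂ p (fun x => u x j) z‖ ^ 2) (Iio 0) :=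
    fun j => integrableOn_fmode_sq hL₁ hL₂ (hu j).continuous (hi j) p
  simp only [fun i j => fmode_add (L₁ := L₁) (L₂ := L₂) (p := p) (cpd i j) (cpd j i)]
  by_cases hk : (p.1 / L₁ : ℝ) = 0 ∧ (p.2 / L₂ : ℝ) = 0
  · have hz : ∀ z < 0, fmode L₁ L₂ p (fun x => u x 2) z = 0 := fun z hz =>
      eq_zero_of_hasDerivAt_zero (fun y hy => (hG2 2 y).congr_deriv (by
        simpa [hG0, hG1, hk.1, hk.2] using hdiv' y hy)) (hU 2) hz
    obtain ⟨m, -, rfl, rfl, rfl, rfl, -⟩ := hmed 1 one_pos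
    rw [setIntegral_eq_zero_of_forall_eq_zero fun z hz' => by simp [hz z hz']]
    have := m.g_pos
    have := m.ρp_pos
    have := m.μ_pos
    have hρ : ∀ z, 0 ≤ m.ρ z := fun z => m.ρm_pos.le.trans (m.ρm_le z)
    have h1 : ∀ j, 0 ≤ ∫ z in Iio 0, m.ρ z * ‖fmode L₁ L₂ p (fun x => u x j) z‖ ^ 2 := fun j =>
      integral_nonneg fun z => mul_nonneg (hρ z) (sq_nonneg _)
    have h2 := Finset.sum_nonneg fun j (_ : j ∈ Finset.univ) => h1 j
    positivity
  · have hk0 : 0 < (p.1 / L₁ : ℝ) ^ 2 + (p.2 / L₂ : ℝ) ^ 2 := by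
      refine lt_of_le_of_ne (by positivity) fun h => hk ?_
      have h1 := sq_nonneg (p.1 / L₁ : ℝ)
      have h2 := sq_nonneg (p.2 / L₂ : ℝ)
      exact ⟨pow_eq_zero_iff two_ne_zero |>.1 (by linarith),
        pow_eq_zero_iff two_ne_zero |>.1 (by linarith)⟩
    obtain ⟨m, hmk, rfl, rfl, rfl, rfl, hr⟩ := hmed _ (sqrt_pos.2 hk0)
    rw [← hr]
    exact m.mode_inequality hΛpos (fun lam hl => hΛ _ _ lam ⟨p.1, rfl⟩ ⟨p.2, rfl⟩ hk (hmk ▸ hl))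
      (hmk ▸ sq_sqrt hk0.le) (fun i j => continuous_fmode (cpd i j) L₁ L₂ p) hG0 hG1 hG2 hdiv' hU
      (fun i j => integrableOn_fmode_sq hL₁ hL₂ (cpd i j) (hdi j i) p)

theorem statement14
    (L₁ L₂ μ g a ρm ρp Λ : ℝ) (ρ₀ : ℝ → ℝ)
    (hL₁ : 0 < L₁) (hL₂ : 0 < L₂)
    (hμ : 0 < μ) (hg : 0 < g) (ha : 0 < a) (hρm : 0 < ρm)
    (hρ₀ : ContDiff ℝ (⊤ : ℕ∞) ρ₀) (hρ₀pos : ∀ x ≤ (0 : ℝ), 0 < ρ₀ x)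
    (hρ₀mono : ∀ x ≤ (0 : ℝ), 0 ≤ deriv ρ₀ x)
    (hsupp : tsupport (deriv ρ₀) = Icc (-a) 0)
    (hflat : ∀ x ≤ -a, ρ₀ x = ρm) (hρp : ρ₀ 0 = ρp)
    -- Λ is the supremum over all nonzero lattice frequencies 𝐤 of the characteristic
    -- values of the eigenvalue problem at wave number |𝐤|
    (hΛpos : 0 < Λ)
    (hΛ : IsLUB {lam : ℝ | ∃ k₁ k₂ : ℝ, (∃ m : ℤ, k₁ = m / L₁) ∧ (∃ m : ℤ, k₂ = m / L₂) ∧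
        ¬(k₁ = 0 ∧ k₂ = 0) ∧
        IsCharValue μ g (Real.sqrt (k₁ ^ 2 + k₂ ^ 2)) ρp ρ₀ lam} Λ) :
    -- the inequality for every divergence free u ∈ H¹(Ω)³
    ∀ u : (Fin 3 → ℝ) → Fin 3 → ℝ,
      (∀ i : Fin 3, ContDiff ℝ 1 (fun x => u x i)) →
      (∀ i : Fin 3, Periodic3 L₁ L₂ (fun x => u x i)) →
      (∀ i : Fin 3, Integrable (fun x => (u x i) ^ 2) (volume.restrict (cell L₁ L₂))) →
      (∀ i j : Fin 3, Integrable (fun x => (pd j (fun y => u y i) x) ^ 2)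
          (volume.restrict (cell L₁ L₂))) →
      (∀ x : Fin 3 → ℝ, x 2 < 0 → (∑ i : Fin 3, pd i (fun y => u y i) x) = 0) →
      (∫ x in cell L₁ L₂, g * deriv ρ₀ (x 2) * (u x 2) ^ 2)
        ≤ (∫ y in cellΓ L₁ L₂, g * ρp * (u ![y.1, y.2, 0] 2) ^ 2)
          + Λ ^ 2 * (∫ x in cell L₁ L₂, ρ₀ (x 2) * ∑ i : Fin 3, (u x i) ^ 2)
          + Λ / 2 * (∫ x in cell L₁ L₂, μ * ∑ i : Fin 3, ∑ j : Fin 3,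
              (pd i (fun y => u y j) x + pd j (fun y => u y i) x) ^ 2) := by
  intro u hu hper hi hdi hdiv
  have hmed : ∀ k > 0, ∃ m : Medium,
      m.k = k ∧ m.μ = μ ∧ m.g = g ∧ m.ρp = ρp ∧ m.ρ = ρ₀ ∧ m.r = deriv ρ₀ := fun k hk =>
    exists_medium hμ hg hρm (hρ₀.of_le (by exact_mod_cast le_top)) hρ₀mono hsupp hflat hρp hk
  have hmode := fmode_inequality hL₁ hL₂ hΛpos hmed
    (fun k₁ k₂ lam h1 h2 h3 h4 => hΛ.1 ⟨k₁, k₂, h1, h2, h3, h4⟩) hu hper hi hdi hdiv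
  obtain ⟨m, -, rfl, rfl, rfl, rfl, hr⟩ := hmed 1 one_pos
  rw [← hr] at hmode ⊢
  have hρ : ∀ z, 0 ≤ m.ρ z := fun z => m.ρm_pos.le.trans (m.ρm_le z)
  have cpd : ∀ i j, Continuous (pd i fun y => u y j) := fun i j => continuous_pd (hu j) i
  have cS : ∀ i j, Continuous fun x => pd i (fun y => u y j) x + pd j (fun y => u y i) x :=
    fun i j => (cpd i j).add (cpd j i)
  have iS : ∀ i j, IntegrableOn
      (fun x => (pd i (fun y => u y j) x + pd j (fun y => u y i) x) ^ 2) (cell L₁ L₂) := by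
    intro i j
    refine Integrable.mono' (((hdi j i).add (hdi i j)).const_mul 2)
      ((cS i j).pow 2).aestronglyMeasurable (ae_of_all _ fun x => ?_)
    rw [Real.norm_of_nonneg (sq_nonneg _)]
    simp only [Pi.add_apply]
    nlinarith [sq_nonneg (pd i (fun y => u y j) x - pd j (fun y => u y i) x)]
  have iρ : ∀ j, IntegrableOn (fun x => m.ρ (x 2) * u x j ^ 2) (cell L₁ L₂) := fun j =>
    Integrable.bdd_mul (hi j) (m.ρ_cont.comp (continuous_apply 2)).aestronglyMeasurable
      (ae_of_all _ fun x => m.abs_ρ_le (x 2))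
  have h1 := hasSum_integral_fmode hL₁ hL₂ (hu 2).continuous (hi 2)
    (w := fun z => m.g * m.r z) (m.r_cont.const_mul _)
    (fun z => mul_nonneg m.g_pos.le (m.r_nonneg z))
    (fun z => mul_le_mul_of_nonneg_left (m.r_le z) m.g_pos.le)
  have h2 := (hasSum_fmode_boundary hL₁ hL₂ (hu 2).continuous 0).mul_left (m.g * m.ρp)
  have h3 := (hasSum_sum (s := Finset.univ) fun j _ =>
    hasSum_integral_fmode hL₁ hL₂ (hu j).continuous (hi j) m.ρ_cont hρ m.le_ρp).mul_left (Λ ^ 2)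
  have h4 := (hasSum_sum (s := Finset.univ) fun i _ => hasSum_sum (s := Finset.univ) fun j _ =>
    hasSum_integral_fmode hL₁ hL₂ (cS i j) (iS i j) (w := fun _ => m.μ) continuous_const
      (fun _ => m.μ_pos.le) fun _ => le_rfl).mul_left (Λ / 2)
  have key := hasSum_le hmode h1 ((h2.add h3).add h4)
  simp only [← Finset.mul_sum] at key
  have e3 : ∫ x in cell L₁ L₂, m.ρ (x 2) * ∑ i, u x i ^ 2
      = ∑ i, ∫ x in cell L₁ L₂, m.ρ (x 2) * u x i ^ 2 := by
    simp only [Finset.mul_sum]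
    exact integral_finsetSum _ fun j _ => iρ j
  have e4 : ∫ x in cell L₁ L₂, m.μ * ∑ i, ∑ j,
        (pd i (fun y => u y j) x + pd j (fun y => u y i) x) ^ 2
      = ∑ i, ∑ j, ∫ x in cell L₁ L₂,
        m.μ * (pd i (fun y => u y j) x + pd j (fun y => u y i) x) ^ 2 := by
    simp only [Finset.mul_sum]
    rw [integral_finsetSum _ fun i _ => integrable_finsetSum _ fun j _ => (iS i j).const_mul _]
    exact Finset.sum_congr rfl fun i _ => integral_finsetSum _ fun j _ => (iS i j).const_mul _
  rw [e3, e4, integral_const_mul]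
  refine le_of_mul_le_mul_left ?_ (show 0 < 2 * π * L₁ * (2 * π * L₂) by positivity)
  linear_combination key
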